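/- There exist η > 0, C > 0 and X₀ > 0 such that the following holds for every integer X ≥ X₀ and every real number α. Let L = ⌊X^{θ+η}⌋ and H = ⌊10·X^{1−γ+η}/γ⌋. Then for all reals M, N, U, V ≥ 1 with X^{7/22} ≤ M ≤ X^{8/22}, X/(2M) ≤ N ≤ 4X/M, U ≤ L and V ≤ H, and all complex coefficients a_m (m ∼ M), b_n (n ∼ N), c_l (l a nonzero integer with |l| ∼ U) and d_h (h a nonzero integer with |h| ∼ V) of modulus at most 1, one has |T₃*| ≤ C·X^{1−2η}, where T₃* = Σ_{m ∼ M} Σ_{n ∼ N, mn ∼ X} Σ_{|l| ∼ U} Σ_{|h| ∼ V} a_m·b_n·c_l·d_h·e(α·l·m·n + h·(mn)^γ), the sums running over positive integers m, n and nonzero integers l, h in the indicated ranges. -/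

import Mathlib

open Finset

noncomputable def e (z : ℝ) : ℂ := Complex.exp (2 * Real.pi * Complex.I * z)

noncomputable def nint (x : ℝ) : ℝ := |x - round x|

noncomputable def dyN (Y : ℝ) : Finset ℕ :=
  (Finset.range (⌈Y⌉₊ + 1)).filter fun m => Y/2 ≤ (m:ℝ) ∧ (m:ℝ) < Y

noncomputable def dyZ (Y : ℝ) : Finset ℤ :=
  (Finset.Icc (-(⌈Y⌉₊:ℤ)) (⌈Y⌉₊:ℤ)).filter fun l => l ≠ 0 ∧ Y/2 ≤ |(l:ℝ)| ∧ |(l:ℝ)| < Y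

lemma norm_e (x : ℝ) : ‖e x‖ = 1 := by
  have h : e x = Complex.exp (((2 * Real.pi * x : ℝ) : ℂ) * Complex.I) := by
    unfold e; push_cast; ring_nf
  rw [h, Complex.norm_exp_ofReal_mul_I]

lemma e_add (x y : ℝ) : e (x + y) = e x * e y := by
  unfold e; rw [← Complex.exp_add]; push_cast; ring_nf

lemma conj_e (x : ℝ) : (starRingEnd ℂ) (e x) = e (-x) := by
  unfold e
  rw [← Complex.exp_conj]
  congr 1
  simp only [map_mul, Complex.conj_ofReal, Complex.conj_I, map_ofNat]
  push_cast; ring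

lemma e_eq_cos_sin (x : ℝ) :
    e x = (Real.cos (Real.pi * x) + Real.sin (Real.pi * x) * Complex.I) ^ 2 := by
  rw [Complex.ofReal_cos, Complex.ofReal_sin, ← Complex.exp_mul_I, ← Complex.exp_nat_mul]
  unfold e; push_cast; ring_nf

/-- An explicit form of `1 / (e x - 1)`. -/
noncomputable def invSubOne (x : ℝ) : ℂ :=
  -(1 / 2) - Complex.I / 2 * ((Real.cos (Real.pi * x) / Real.sin (Real.pi * x) : ℝ) : ℂ)

lemma invSubOne_mul (x : ℝ) (h : Real.sin (Real.pi * x) ≠ 0) :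
    invSubOne x * (e x - 1) = 1 := by
  rw [e_eq_cos_sin]
  unfold invSubOne
  have h1 := Real.sin_sq_add_cos_sq (Real.pi * x)
  generalize Real.sin (Real.pi * x) = s at *
  generalize Real.cos (Real.pi * x) = k at *
  have hs : (s : ℂ) ≠ 0 := by exact_mod_cast h
  have h2 : (s : ℂ) ^ 2 + (k : ℂ) ^ 2 = 1 := by exact_mod_cast h1
  push_cast
  have hI := Complex.I_sq
  field_simp
  linear_combination (-(s : ℂ) ^ 3 - s ^ 2 * k * Complex.I - 2 * s * k ^ 2) * hI + (s - Complex.I * k) * h2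

lemma sin_pi_mul_pos {x : ℝ} (h0 : 0 < x) (h1 : x < 1) : 0 < Real.sin (Real.pi * x) :=
  Real.sin_pos_of_pos_of_lt_pi (by positivity) (by nlinarith [Real.pi_pos])

lemma two_mul_le_sin_pi_mul {δ x : ℝ} (hδ : 0 < δ) (h0 : δ ≤ x) (h1 : x ≤ 1 - δ) :
    2 * δ ≤ Real.sin (Real.pi * x) := by
  have hp := Real.pi_pos
  have key : ∀ y : ℝ, δ ≤ y → y ≤ 1 / 2 → 2 * δ ≤ Real.sin (Real.pi * y) := by
    intro y hy1 hy2
    have := Real.mul_le_sin (x := Real.pi * y) (by nlinarith) (by nlinarith)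
    have h2 : 2 / Real.pi * (Real.pi * y) = 2 * y := by field_simp
    linarith
  rcases le_total x (1 / 2) with h | h
  · exact key x h0 h
  · have := key (1 - x) (by linarith) (by linarith)
    rwa [mul_sub, mul_one, Real.sin_pi_sub] at this

lemma norm_invSubOne_sub {x y : ℝ} (h0 : 0 < x) (hxy : x ≤ y) (h1 : y < 1) :
    ‖invSubOne x - invSubOne y‖ ≤
      1 / 2 * (Real.cos (Real.pi * x) / Real.sin (Real.pi * x))
        - 1 / 2 * (Real.cos (Real.pi * y) / Real.sin (Real.pi * y)) := by
  have hx := sin_pi_mul_pos h0 (by linarith)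
  have hy := sin_pi_mul_pos (by linarith : 0 < y) h1
  have hpos : 0 ≤ Real.cos (Real.pi * x) / Real.sin (Real.pi * x)
      - Real.cos (Real.pi * y) / Real.sin (Real.pi * y) := by
    rw [div_sub_div _ _ hx.ne' hy.ne']
    apply div_nonneg _ (by positivity)
    have : 0 ≤ Real.sin (Real.pi * y - Real.pi * x) :=
      Real.sin_nonneg_of_nonneg_of_le_pi (by nlinarith [Real.pi_pos]) (by nlinarith [Real.pi_pos])
    rw [Real.sin_sub] at this
    linarith
  have : invSubOne x - invSubOne y = -(Complex.I / 2) *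
      ((Real.cos (Real.pi * x) / Real.sin (Real.pi * x)
      - Real.cos (Real.pi * y) / Real.sin (Real.pi * y) : ℝ) : ℂ) := by
    unfold invSubOne; push_cast; ring
  rw [this, norm_mul, Complex.norm_real, Real.norm_of_nonneg hpos]
  simp
  linarith

lemma norm_invSubOne_le {δ x : ℝ} (hδ : 0 < δ) (h0 : δ ≤ x) (h1 : x ≤ 1 - δ) :
    ‖invSubOne x‖ ≤ 1 / (4 * δ) := by
  have hs := two_mul_le_sin_pi_mul hδ h0 h1
  have hs0 : 0 < Real.sin (Real.pi * x) := by linarith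
  have h := congrArg norm (invSubOne_mul x hs0.ne')
  rw [norm_mul, norm_one] at h
  have h2 : 4 * δ ≤ ‖e x - 1‖ := by
    have h3 : e x - 1 = 2 * Complex.I * Real.sin (Real.pi * x) *
        (Real.cos (Real.pi * x) + Real.sin (Real.pi * x) * Complex.I) := by
      rw [e_eq_cos_sin]
      have h1 : (Real.sin (Real.pi * x) : ℂ) ^ 2 + (Real.cos (Real.pi * x) : ℂ) ^ 2 = 1 := by
        exact_mod_cast Real.sin_sq_add_cos_sq (Real.pi * x)
      linear_combination (- (Real.sin (Real.pi * x) : ℂ) ^ 2) * Complex.I_sq + h1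
    rw [h3, norm_mul, Complex.ofReal_cos, Complex.ofReal_sin, ← Complex.exp_mul_I]
    rw [Complex.norm_exp_ofReal_mul_I, ← Complex.ofReal_sin]
    simp only [norm_mul, Complex.norm_ofNat, Complex.norm_I, Complex.norm_real,
      Real.norm_of_nonneg hs0.le]
    linarith
  rw [le_div_iff₀ (by positivity)]
  calc _ ≤ ‖invSubOne x‖ * ‖e x - 1‖ := by gcongr
    _ = 1 := h

/-- The Kusmin–Landau inequality, for monotone differences in `[δ, 1 - δ]`. -/
lemma kusmin_landau_aux (f : ℕ → ℝ) (J : ℕ) {δ : ℝ} (hδ : 0 < δ)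
    (hlo : ∀ n < J, δ ≤ f (n + 1) - f n) (hhi : ∀ n < J, f (n + 1) - f n ≤ 1 - δ)
    (hmono : ∀ n, n + 1 < J → f (n + 1) - f n ≤ f (n + 2) - f (n + 1)) :
    ‖∑ n ∈ range J, e (f n)‖ ≤ 1 / δ := by
  rcases J with _ | J
  · simp; positivity
  set G : ℕ → ℂ := fun n => invSubOne (f (n + 1) - f n) with hG
  set k : ℕ → ℝ := fun n => 1 / 2 * (Real.cos (Real.pi * (f (n + 1) - f n)) /
    Real.sin (Real.pi * (f (n + 1) - f n))) with hk
  have hE : ∀ n < J + 1, e (f n) = G n * (e (f (n + 1)) - e (f n)) := by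
    intro n hn
    have h1 := hlo n hn
    have h2 := hhi n hn
    have := invSubOne_mul (f (n + 1) - f n)
      (sin_pi_mul_pos (by linarith) (by linarith)).ne'
    have h3 : e (f (n + 1)) = e (f n) * e (f (n + 1) - f n) := by
      rw [← e_add]; congr 1; ring
    rw [h3]
    linear_combination (-e (f n)) * this
  have main : ∀ j ≤ J, ‖∑ n ∈ range (j + 1), e (f n) - G j * e (f (j + 1))‖ ≤
      ‖G 0‖ + (k 0 - k j) := by
    intro j
    induction j with
    | zero =>
      intro _
      simp only [zero_add, sum_range_one, sub_self, add_zero]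
      have : e (f 0) - G 0 * e (f 1) = - (G 0 * e (f 0)) := by
        have := hE 0 (by omega)
        linear_combination this
      rw [this, norm_neg, norm_mul, norm_e, mul_one]
    | succ j ih =>
      intro hj
      have ih' := ih (by omega)
      rw [sum_range_succ]
      have h1 : ∑ n ∈ range (j + 1), e (f n) + e (f (j + 1)) - G (j + 1) * e (f (j + 1 + 1)) =
          (∑ n ∈ range (j + 1), e (f n) - G j * e (f (j + 1))) +
            (G j - G (j + 1)) * e (f (j + 1)) := by
        have := hE (j + 1) (by omega)
        linear_combination this
      rw [h1]
      refine (norm_add_le _ _).trans ?_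
      rw [norm_mul, norm_e, mul_one]
      have h2 : ‖G j - G (j + 1)‖ ≤ k j - k (j + 1) := by
        apply norm_invSubOne_sub
        · have := hlo j (by omega); linarith
        · exact hmono j (by omega)
        · have := hhi (j + 1) (by omega); linarith
      linarith
  have hm := main J le_rfl
  have hG' : ∀ n < J + 1, ‖G n‖ ≤ 1 / (4 * δ) := fun n hn =>
    norm_invSubOne_le hδ (hlo n hn) (hhi n hn)
  have hk' : ∀ n < J + 1, |k n| ≤ 1 / (4 * δ) := by
    intro n hn
    have hs := two_mul_le_sin_pi_mul hδ (hlo n hn) (hhi n hn)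
    simp only [hk]
    rw [abs_mul, abs_of_pos (by norm_num : (0:ℝ) < 1 / 2), abs_div,
      abs_of_pos (by linarith : 0 < Real.sin (Real.pi * (f (n + 1) - f n)))]
    have : |Real.cos (Real.pi * (f (n + 1) - f n))| /
        Real.sin (Real.pi * (f (n + 1) - f n)) ≤ 1 / (2 * δ) := by
      apply div_le_div₀ (by norm_num) (Real.abs_cos_le_one _) (by positivity) hs
    calc _ ≤ 1 / 2 * (1 / (2 * δ)) := by gcongr
      _ = _ := by field_simp; norm_num
  have h0 := hk' 0 (by omega)
  have hJ := hk' J (by omega)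
  have hG0 := hG' 0 (by omega)
  have hGJ := hG' J (by omega)
  have : ‖∑ n ∈ range (J + 1), e (f n)‖ ≤
      ‖∑ n ∈ range (J + 1), e (f n) - G J * e (f (J + 1))‖ + ‖G J‖ := by
    calc _ = ‖(∑ n ∈ range (J + 1), e (f n) - G J * e (f (J + 1))) + G J * e (f (J + 1))‖ := by
          congr 1; ring
      _ ≤ _ := by
          refine (norm_add_le _ _).trans ?_
          rw [norm_mul, norm_e, mul_one]
  have h4 : 1 / δ = 4 * (1 / (4 * δ)) := by field_simp
  rw [h4]
  have := (abs_le.1 h0).2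
  have := (abs_le.1 hJ).1
  linarith

lemma e_sub_int_mul (x : ℝ) (k : ℤ) (n : ℕ) : e (x - k * n) = e x := by
  have h : e (-(((k * n : ℤ) : ℝ))) = 1 := by
    have := Complex.exp_int_mul_two_pi_mul_I (-(k * n))
    rw [← this]; unfold e; push_cast; ring_nf
  rw [sub_eq_add_neg, e_add]
  have h2 : -((k : ℝ) * (n : ℝ)) = -(((k * n : ℤ) : ℝ)) := by push_cast; ring
  rw [h2, h, mul_one]

lemma exists_eq_Ico_of_ordConnected (S : Finset ℕ)
    (h : ∀ x ∈ S, ∀ z ∈ S, ∀ y, x ≤ y → y ≤ z → y ∈ S) : ∃ a b, S = Ico a b := by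
  rcases S.eq_empty_or_nonempty with rfl | hS
  · exact ⟨0, 0, by simp⟩
  · refine ⟨S.min' hS, S.max' hS + 1, ?_⟩
    ext y
    rw [mem_Ico]
    constructor
    · intro hy
      exact ⟨S.min'_le _ hy, Nat.lt_succ_of_le (S.le_max' _ hy)⟩
    · rintro ⟨h1, h2⟩
      exact h _ (S.min'_mem hS) _ (S.max'_mem hS) _ h1 (Nat.le_of_lt_succ h2)

/-- The Kusmin–Landau inequality. -/
lemma kusmin_landau (f : ℕ → ℝ) (a b : ℕ) (k : ℤ) {δ : ℝ} (hδ : 0 < δ)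
    (hlo : ∀ n ∈ Ico a b, k + δ ≤ f (n + 1) - f n)
    (hhi : ∀ n ∈ Ico a b, f (n + 1) - f n ≤ k + 1 - δ)
    (hmono : ∀ n ∈ Ico a b, n + 1 ∈ Ico a b → f (n + 1) - f n ≤ f (n + 2) - f (n + 1)) :
    ‖∑ n ∈ Ico a b, e (f n)‖ ≤ 1 / δ := by
  rw [sum_Ico_eq_sum_range]
  have := kusmin_landau_aux (fun n => f (a + n) - k * n) (b - a) hδ
    (by
      intro n hn
      have := hlo (a + n) (mem_Ico.2 (by omega))
      push_cast
      rw [← add_assoc]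
      linarith)
    (by
      intro n hn
      have := hhi (a + n) (mem_Ico.2 (by omega))
      push_cast
      rw [← add_assoc]
      linarith)
    (by
      intro n hn
      have := hmono (a + n) (mem_Ico.2 (by omega)) (mem_Ico.2 (by omega))
      push_cast
      rw [← add_assoc, ← add_assoc]
      linarith)
  simpa only [e_sub_int_mul] using this

lemma card_le_of_sub_le (S : Finset ℕ) {t : ℝ} (ht : 0 ≤ t)
    (h : ∀ m ∈ S, ∀ n ∈ S, m ≤ n → (n : ℝ) - m ≤ t) : (#S : ℝ) ≤ t + 1 := by
  rcases S.eq_empty_or_nonempty with rfl | hS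
  · simp; linarith
  · have h1 := h _ (S.min'_mem hS) _ (S.max'_mem hS) (S.min'_le_max' hS)
    have hsub : S ⊆ Icc (S.min' hS) (S.max' hS) := fun y hy =>
      mem_Icc.2 ⟨S.min'_le _ hy, S.le_max' _ hy⟩
    have h2 := card_le_card hsub
    rw [Nat.card_Icc] at h2
    have h3 := S.min'_le_max' hS
    have h4 : #S + S.min' hS ≤ S.max' hS + 1 := by omega
    have h5 : (#S : ℝ) + (S.min' hS : ℕ) ≤ (S.max' hS : ℕ) + 1 := by exact_mod_cast h4
    linarith

lemma norm_sum_e_le_card (S : Finset ℕ) (f : ℕ → ℝ) : ‖∑ n ∈ S, e (f n)‖ ≤ #S := by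
  refine (norm_sum_le _ _).trans ?_
  simp [norm_e]

/-- Van der Corput's second derivative test, for second differences. -/
lemma norm_sum_e_le_of_second_diff (f : ℕ → ℝ) (J : ℕ) {l L : ℝ} (hl : 0 < l) (hlL : l ≤ L)
    (hlo : ∀ n, n + 1 < J → l ≤ (f (n + 2) - f (n + 1)) - (f (n + 1) - f n))
    (hhi : ∀ n, n + 1 < J → (f (n + 2) - f (n + 1)) - (f (n + 1) - f n) ≤ L) :
    ‖∑ n ∈ range J, e (f n)‖ ≤ 4 * (J * L + 2) / √l := by
  have hs : 0 < √l := Real.sqrt_pos.2 hl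
  have hsq : √l * √l = l := Real.mul_self_sqrt hl.le
  rcases lt_or_ge (1 / 4) l with hbig | hsmall
  · refine (norm_sum_e_le_card _ _).trans ?_
    rw [card_range, le_div_iff₀ hs]
    have h1 : 1 / 2 ≤ √l := by
      apply Real.le_sqrt_of_sq_le; linarith
    have hJ : (0 : ℝ) ≤ J := Nat.cast_nonneg J
    have h2 : √l ≤ 2 * l := by nlinarith
    have : (J : ℝ) * √l ≤ J * (2 * L) := by
      apply mul_le_mul_of_nonneg_left _ hJ; linarith
    nlinarith [mul_nonneg hJ (hl.le.trans hlL)]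
  rcases J.eq_zero_or_pos with rfl | hJpos
  · simp; positivity
  set δ := √l with hδ
  have hδ2 : δ ≤ 1 / 2 := by
    rw [hδ, Real.sqrt_le_left (by norm_num)]; linarith
  set d : ℕ → ℝ := fun n => f (n + 1) - f n with hd
  have hstep : ∀ n, n + 1 < J → l ≤ d (n + 1) - d n ∧ d (n + 1) - d n ≤ L :=
    fun n hn => ⟨hlo n hn, hhi n hn⟩
  have hinc : ∀ m j, m + j < J → l * j ≤ d (m + j) - d m ∧ d (m + j) - d m ≤ L * j := by
    intro m j
    induction j with
    | zero => intro _; simp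
    | succ j ih =>
      intro hj
      have h1 := ih (by omega)
      have h2 := hstep (m + j) (by omega)
      rw [← add_assoc]
      push_cast
      constructor <;> linarith [h1.1, h1.2, h2.1, h2.2]
  have hinc' : ∀ m n, m ≤ n → n < J → l * ((n : ℝ) - m) ≤ d n - d m ∧
      d n - d m ≤ L * ((n : ℝ) - m) := by
    intro m n hmn hn
    have := hinc m (n - m) (by omega)
    rw [Nat.add_sub_cancel' hmn, Nat.cast_sub hmn] at this
    exact this
  have hmono : ∀ m n, m ≤ n → n < J → d m ≤ d n := by
    intro m n hmn hn
    have := (hinc' m n hmn hn).1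
    have h2 : (m : ℝ) ≤ n := by exact_mod_cast hmn
    nlinarith
  have hshort : ∀ (S : Finset ℕ) (x : ℝ), (∀ n ∈ S, n < J ∧ x ≤ d n ∧ d n ≤ x + δ) →
      (#S : ℝ) ≤ 1 / δ + 1 := by
    intro S x hS
    apply card_le_of_sub_le _ (by positivity)
    intro m hm n hn hmn
    have h1 := (hinc' m n hmn (hS n hn).1).1
    have h2 := (hS n hn).2.2
    have h3 := (hS m hm).2.1
    rw [le_div_iff₀ hs]
    have : δ * (((n : ℝ) - m) * δ) ≤ δ * 1 := by
      calc δ * (((n : ℝ) - m) * δ) = l * ((n : ℝ) - m) := by rw [← hsq]; ring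
        _ ≤ δ * 1 := by linarith
    exact le_of_mul_le_mul_left this hs
  have hfib : ∀ k : ℤ, ‖∑ n ∈ (range J).filter (fun n => ⌊d n⌋ = k), e (f n)‖ ≤ 4 * (1 / δ) := by
    intro k
    set S := (range J).filter (fun n => ⌊d n⌋ = k) with hS
    have hmem : ∀ n ∈ S, n < J ∧ (k : ℝ) ≤ d n ∧ d n < k + 1 := by
      intro n hn
      rw [hS, mem_filter, mem_range, Int.floor_eq_iff] at hn
      exact ⟨hn.1, hn.2.1, hn.2.2⟩
    rw [← sum_filter_add_sum_filter_not S (fun n => d n < k + δ),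
      ← sum_filter_add_sum_filter_not (S.filter (fun n => ¬ d n < k + δ))
        (fun n => k + 1 - δ < d n)]
    have hA : ‖∑ n ∈ S.filter (fun n => d n < k + δ), e (f n)‖ ≤ 1 / δ + 1 := by
      refine (norm_sum_e_le_card _ _).trans (hshort _ k ?_)
      intro n hn
      rw [mem_filter] at hn
      exact ⟨(hmem n hn.1).1, (hmem n hn.1).2.1, hn.2.le⟩
    have hB : ‖∑ n ∈ (S.filter (fun n => ¬ d n < k + δ)).filter (fun n => k + 1 - δ < d n),
        e (f n)‖ ≤ 1 / δ + 1 := by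
      refine (norm_sum_e_le_card _ _).trans (hshort _ (k + 1 - δ) ?_)
      intro n hn
      rw [mem_filter, mem_filter] at hn
      refine ⟨(hmem n hn.1.1).1, hn.2.le, ?_⟩
      linarith [(hmem n hn.1.1).2.2]
    have hC : ‖∑ n ∈ (S.filter (fun n => ¬ d n < k + δ)).filter (fun n => ¬ k + 1 - δ < d n),
        e (f n)‖ ≤ 1 / δ := by
      set T := (S.filter (fun n => ¬ d n < k + δ)).filter (fun n => ¬ k + 1 - δ < d n) with hT
      have hTm : ∀ n, n ∈ T ↔ n < J ∧ k + δ ≤ d n ∧ d n ≤ k + 1 - δ := by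
        intro n
        rw [hT, mem_filter, mem_filter, hS, mem_filter, mem_range, Int.floor_eq_iff, not_lt,
          not_lt]
        constructor
        · rintro ⟨⟨⟨h1, h2⟩, h3⟩, h4⟩; exact ⟨h1, h3, h4⟩
        · rintro ⟨h1, h3, h4⟩
          exact ⟨⟨⟨h1, by linarith, by linarith⟩, h3⟩, h4⟩
      obtain ⟨a, b, hab⟩ := exists_eq_Ico_of_ordConnected T (by
        intro x hx z hz y hxy hyz
        rw [hTm] at hx hz ⊢
        have h1 := hmono x y hxy (by omega)
        have h2 := hmono y z hyz hz.1
        exact ⟨by omega, by linarith, by linarith⟩)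
      rw [hab]
      apply kusmin_landau f a b k hs
      · intro n hn
        rw [← hab, hTm] at hn
        exact hn.2.1
      · intro n hn
        rw [← hab, hTm] at hn
        exact hn.2.2
      · intro n hn hn1
        rw [← hab, hTm] at hn hn1
        exact hmono n (n + 1) (by omega) hn1.1
    have h2 : 2 ≤ 1 / δ := by rw [le_div_iff₀ hs]; linarith
    have hBC := (norm_add_le _ _).trans (add_le_add hB hC)
    have hABC := (norm_add_le _ _).trans (add_le_add hA hBC)
    have : 1 / δ + 1 + (1 / δ + 1 + 1 / δ) ≤ 4 * (1 / δ) := by linarith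
    exact hABC.trans this
  have hmaps : ∀ n ∈ range J, ⌊d n⌋ ∈ Icc ⌊d 0⌋ ⌊d (J - 1)⌋ := by
    intro n hn
    rw [mem_range] at hn
    rw [mem_Icc]
    exact ⟨Int.floor_le_floor (hmono 0 n (by omega) hn),
      Int.floor_le_floor (hmono n (J - 1) (by omega) (by omega))⟩
  rw [← sum_fiberwise_of_maps_to hmaps]
  refine (norm_sum_le _ _).trans ?_
  refine (sum_le_sum (fun k _ => hfib k)).trans ?_
  rw [sum_const, nsmul_eq_mul, Int.card_Icc]
  have hle : ⌊d 0⌋ ≤ ⌊d (J - 1)⌋ := Int.floor_le_floor (hmono 0 (J - 1) (by omega) (by omega))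
  have hcard : (((⌊d (J - 1)⌋ + 1 - ⌊d 0⌋).toNat : ℕ) : ℝ) ≤ J * L + 2 := by
    have h1 : (((⌊d (J - 1)⌋ + 1 - ⌊d 0⌋).toNat : ℕ) : ℝ) =
        ((⌊d (J - 1)⌋ + 1 - ⌊d 0⌋ : ℤ) : ℝ) := by
      rw [← Int.cast_natCast, Int.toNat_of_nonneg (by omega)]
    rw [h1]
    push_cast
    have h2 := Int.floor_le (d (J - 1))
    have h3 := Int.lt_floor_add_one (d 0)
    have h4 := (hinc' 0 (J - 1) (by omega) (by omega)).2
    rw [Nat.cast_sub hJpos] at h4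
    push_cast at h4
    have : 0 < L := hl.trans_le hlL
    nlinarith
  calc _ ≤ (J * L + 2) * (4 * (1 / δ)) := by gcongr
    _ = _ := by ring

lemma exists_second_diff_rpow {γ x : ℝ} (hx : 0 < x) :
    ∃ z, x < z ∧ z < x + 2 ∧ ((x + 2) ^ γ - (x + 1) ^ γ) - ((x + 1) ^ γ - x ^ γ) =
      γ * (γ - 1) * z ^ (γ - 2) := by
  have hder : ∀ (p y : ℝ), 0 < y → HasDerivAt (fun t : ℝ => t ^ p) (p * y ^ (p - 1)) y :=
    fun p y hy => Real.hasDerivAt_rpow_const (Or.inl hy.ne')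
  have hder1 : ∀ (p y : ℝ), 0 < y →
      HasDerivAt (fun t : ℝ => (t + 1) ^ p) (p * (y + 1) ^ (p - 1)) y := by
    intro p y hy
    simpa using (hder p (y + 1) (by linarith)).comp_add_const y 1
  have h1 : ∀ y, 0 < y → HasDerivAt (fun t : ℝ => (t + 1) ^ γ - t ^ γ)
      (γ * (y + 1) ^ (γ - 1) - γ * y ^ (γ - 1)) y :=
    fun y hy => (hder1 γ y hy).sub (hder γ y hy)
  obtain ⟨u, ⟨hu1, hu2⟩, hu⟩ := exists_hasDerivAt_eq_slope
    (fun t : ℝ => (t + 1) ^ γ - t ^ γ) (fun y => γ * (y + 1) ^ (γ - 1) - γ * y ^ (γ - 1))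
    (by linarith : x < x + 1)
    (fun y hy => (h1 y (by linarith [hy.1])).continuousAt.continuousWithinAt)
    (fun y hy => h1 y (by linarith [hy.1]))
  obtain ⟨z, ⟨hz1, hz2⟩, hz⟩ := exists_hasDerivAt_eq_slope
    (fun t : ℝ => t ^ (γ - 1)) (fun y => (γ - 1) * y ^ (γ - 1 - 1))
    (by linarith : u < u + 1)
    (fun y hy => (hder (γ - 1) y (by linarith [hy.1])).continuousAt.continuousWithinAt)
    (fun y hy => hder (γ - 1) y (by linarith [hy.1]))
  refine ⟨z, by linarith, by linarith, ?_⟩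
  simp only [add_sub_cancel_left, div_one] at hu hz
  have e1 : γ - 1 - 1 = γ - 2 := by ring
  have e2 : x + 1 + 1 = x + 2 := by ring
  rw [e1] at hz
  rw [e2] at hu
  linear_combination -hu - γ * hz

lemma norm_sum_e_neg (S : Finset ℕ) (f : ℕ → ℝ) :
    ‖∑ n ∈ S, e (-f n)‖ = ‖∑ n ∈ S, e (f n)‖ := by
  rw [← Complex.norm_conj (∑ n ∈ S, e (f n)), map_sum]
  simp only [conj_e]

lemma norm_sum_e_linear_add_rpow_le_aux {γ : ℝ} (h0 : 0 < γ) (h1 : γ < 1) {N : ℝ} (hN : 1 ≤ N)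
    (β : ℝ) {Δ : ℝ} (hΔ : Δ < 0) (a b : ℕ)
    (hab : ∀ n ∈ Ico a b, N / 2 ≤ (n : ℝ) ∧ (n : ℝ) < N) :
    ‖∑ n ∈ Ico a b, e (β * n + Δ * (n : ℝ) ^ γ)‖ ≤
      64 * (N * √(γ * (1 - γ) * (-Δ) * N ^ (γ - 2)) +
        1 / √(γ * (1 - γ) * (-Δ) * N ^ (γ - 2))) := by
  have hN0 : 0 < N := by linarith
  set g := γ * (1 - γ) * (-Δ) * N ^ (γ - 2) with hg
  have hq : 0 < γ * (1 - γ) * (-Δ) := by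
    have : 0 < 1 - γ := by linarith
    have : 0 < -Δ := by linarith
    positivity
  have hg0 : 0 < g := by positivity
  have hs : 0 < √g := Real.sqrt_pos.2 hg0
  rcases le_or_gt b a with hba | hba
  · rw [Ico_eq_empty (by omega)]
    simp only [sum_empty, norm_zero]
    positivity
  have hstep : ∀ n, n + 1 < b - a → g / 4 ≤ ((β * ((a + (n + 2) : ℕ) : ℝ) +
      Δ * ((a + (n + 2) : ℕ) : ℝ) ^ γ) - (β * ((a + (n + 1) : ℕ) : ℝ) +
      Δ * ((a + (n + 1) : ℕ) : ℝ) ^ γ)) - ((β * ((a + (n + 1) : ℕ) : ℝ) +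
      Δ * ((a + (n + 1) : ℕ) : ℝ) ^ γ) - (β * ((a + n : ℕ) : ℝ) +
      Δ * ((a + n : ℕ) : ℝ) ^ γ)) ∧ ((β * ((a + (n + 2) : ℕ) : ℝ) +
      Δ * ((a + (n + 2) : ℕ) : ℝ) ^ γ) - (β * ((a + (n + 1) : ℕ) : ℝ) +
      Δ * ((a + (n + 1) : ℕ) : ℝ) ^ γ)) - ((β * ((a + (n + 1) : ℕ) : ℝ) +
      Δ * ((a + (n + 1) : ℕ) : ℝ) ^ γ) - (β * ((a + n : ℕ) : ℝ) +
      Δ * ((a + n : ℕ) : ℝ) ^ γ)) ≤ 4 * g := by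
    intro n hn
    have hx1 := (hab (a + n) (mem_Ico.2 (by omega))).1
    have hx2 := (hab (a + (n + 1)) (mem_Ico.2 (by omega))).2
    set x : ℝ := ((a + n : ℕ) : ℝ) with hx
    have e1 : ((a + (n + 1) : ℕ) : ℝ) = x + 1 := by rw [hx]; push_cast; ring
    have e2 : ((a + (n + 2) : ℕ) : ℝ) = x + 2 := by rw [hx]; push_cast; ring
    rw [e1] at hx2
    rw [e1, e2]
    obtain ⟨z, hz1, hz2, hz⟩ := exists_second_diff_rpow (γ := γ) (x := x) (by linarith)
    have e3 : ((β * (x + 2) + Δ * (x + 2) ^ γ) - (β * (x + 1) + Δ * (x + 1) ^ γ)) -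
        ((β * (x + 1) + Δ * (x + 1) ^ γ) - (β * x + Δ * x ^ γ)) =
        γ * (1 - γ) * (-Δ) * z ^ (γ - 2) := by
      linear_combination Δ * hz
    rw [e3]
    have hz0 : 0 < z := by linarith
    have hlow : N ^ (γ - 2) / 4 ≤ z ^ (γ - 2) := by
      calc N ^ (γ - 2) / 4 ≤ (2 : ℝ) ^ (γ - 2) * N ^ (γ - 2) := by
            have h3 : (2 : ℝ) ^ (-2 : ℝ) ≤ (2 : ℝ) ^ (γ - 2) :=
              Real.rpow_le_rpow_of_exponent_le (by norm_num) (by linarith)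
            have h4 : (2 : ℝ) ^ (-2 : ℝ) = 1 / 4 := by
              rw [Real.rpow_neg (by norm_num)]; norm_num
            rw [h4] at h3
            rw [div_eq_mul_one_div, mul_comm]
            gcongr
        _ = (2 * N) ^ (γ - 2) := by rw [Real.mul_rpow (by norm_num) hN0.le]
        _ ≤ z ^ (γ - 2) :=
            Real.rpow_le_rpow_of_nonpos hz0 (by linarith) (by linarith)
    have hhigh : z ^ (γ - 2) ≤ 4 * N ^ (γ - 2) := by
      calc z ^ (γ - 2) ≤ (1 / 2 * N) ^ (γ - 2) :=
            Real.rpow_le_rpow_of_nonpos (by positivity) (by linarith) (by linarith)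
        _ = (1 / 2 : ℝ) ^ (γ - 2) * N ^ (γ - 2) := by rw [Real.mul_rpow (by norm_num) hN0.le]
        _ ≤ 4 * N ^ (γ - 2) := by
            have : (1 / 2 : ℝ) ^ (γ - 2) ≤ (1 / 2 : ℝ) ^ (-2 : ℝ) :=
              Real.rpow_le_rpow_of_exponent_ge (by norm_num) (by norm_num) (by linarith)
            have h4 : (1 / 2 : ℝ) ^ (-2 : ℝ) = 4 := by
              rw [Real.rpow_neg (by norm_num)]; norm_num
            have : 0 < N ^ (γ - 2) := by positivity
            nlinarith
    constructor
    · calc g / 4 = γ * (1 - γ) * (-Δ) * (N ^ (γ - 2) / 4) := by rw [hg]; ring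
        _ ≤ _ := by gcongr
    · calc _ ≤ γ * (1 - γ) * (-Δ) * (4 * N ^ (γ - 2)) := by gcongr
        _ = _ := by rw [hg]; ring
  have main := norm_sum_e_le_of_second_diff
    (fun n => β * ((a + n : ℕ) : ℝ) + Δ * ((a + n : ℕ) : ℝ) ^ γ) (b - a)
    (by positivity : 0 < g / 4) (by linarith : g / 4 ≤ 4 * g)
    (fun n hn => (hstep n hn).1) (fun n hn => (hstep n hn).2)
  rw [sum_Ico_eq_sum_range]
  refine main.trans ?_
  have hJ : ((b - a : ℕ) : ℝ) ≤ 2 * N := by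
    have h1 := (hab a (mem_Ico.2 ⟨le_rfl, hba⟩)).1
    have h2 := (hab (b - 1) (mem_Ico.2 ⟨by omega, by omega⟩)).2
    rw [Nat.cast_sub (by omega)] at h2
    rw [Nat.cast_sub hba.le]
    push_cast at h2
    linarith
  have hsq : √(g / 4) = √g / 2 := by
    rw [Real.sqrt_div' _ (by norm_num)]
    congr 1
    rw [show (4 : ℝ) = 2 ^ 2 by norm_num, Real.sqrt_sq (by norm_num)]
  rw [hsq]
  have hgg : g / √g = √g := Real.div_sqrt
  calc 4 * (((b - a : ℕ) : ℝ) * (4 * g) + 2) / (√g / 2)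
      ≤ 4 * (2 * N * (4 * g) + 2) / (√g / 2) := by gcongr
    _ = 64 * N * (g / √g) + 16 * (1 / √g) := by field_simp; ring
    _ ≤ 64 * (N * √g + 1 / √g) := by
      rw [hgg]
      have : 0 < 1 / √g := by positivity
      linarith

lemma norm_sum_e_linear_add_rpow_le {γ : ℝ} (h0 : 0 < γ) (h1 : γ < 1) {N : ℝ} (hN : 1 ≤ N)
    (β : ℝ) {Δ D₀ D₁ : ℝ} (hD₀ : 0 < D₀) (hΔ₀ : D₀ ≤ |Δ|) (hΔ₁ : |Δ| ≤ D₁) (a b : ℕ)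
    (hab : ∀ n ∈ Ico a b, N / 2 ≤ (n : ℝ) ∧ (n : ℝ) < N) :
    ‖∑ n ∈ Ico a b, e (β * n + Δ * (n : ℝ) ^ γ)‖ ≤
      64 / √(γ * (1 - γ)) * (√(D₁ * N ^ γ) + N / √(D₀ * N ^ γ)) := by
  have hN0 : 0 < N := by linarith
  have hγ : 0 < γ * (1 - γ) := mul_pos h0 (by linarith)
  have hΔpos : 0 < |Δ| := by linarith
  have key : ‖∑ n ∈ Ico a b, e (β * n + Δ * (n : ℝ) ^ γ)‖ ≤
      64 * (N * √(γ * (1 - γ) * |Δ| * N ^ (γ - 2)) +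
        1 / √(γ * (1 - γ) * |Δ| * N ^ (γ - 2))) := by
    rcases lt_or_gt_of_ne (abs_pos.1 hΔpos) with hneg | hpos
    · rw [abs_of_neg hneg]
      exact norm_sum_e_linear_add_rpow_le_aux h0 h1 hN β hneg a b hab
    · rw [abs_of_pos hpos, ← norm_sum_e_neg]
      have := norm_sum_e_linear_add_rpow_le_aux h0 h1 hN (-β) (neg_lt_zero.2 hpos) a b hab
      rw [neg_neg] at this
      convert this using 6
      ring
  have hpow : N ^ (γ - 2) = N ^ γ / N ^ 2 := by
    rw [Real.rpow_sub hN0]; norm_num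
  have hsq : √(γ * (1 - γ) * |Δ| * N ^ (γ - 2)) = √(γ * (1 - γ)) * √(|Δ| * N ^ γ) / N := by
    rw [hpow, ← Real.sqrt_mul hγ.le, show γ * (1 - γ) * |Δ| * (N ^ γ / N ^ 2) =
      γ * (1 - γ) * (|Δ| * N ^ γ) / N ^ 2 by ring, Real.sqrt_div' _ (by positivity),
      Real.sqrt_sq hN0.le]
  have hs1 : √(γ * (1 - γ)) ≤ 1 := by
    rw [Real.sqrt_le_one]; nlinarith
  have hs0 : 0 < √(γ * (1 - γ)) := Real.sqrt_pos.2 hγ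
  have hNγ : 0 < N ^ γ := by positivity
  rw [hsq] at key
  have hA : √(|Δ| * N ^ γ) ≤ √(D₁ * N ^ γ) := Real.sqrt_le_sqrt (by gcongr)
  have hB : √(D₀ * N ^ γ) ≤ √(|Δ| * N ^ γ) := Real.sqrt_le_sqrt (by gcongr)
  have hB0 : 0 < √(D₀ * N ^ γ) := Real.sqrt_pos.2 (by positivity)
  have hC0 : 0 < √(|Δ| * N ^ γ) := hB0.trans_le hB
  refine key.trans ?_
  set s := √(γ * (1 - γ))
  calc 64 * (N * (s * √(|Δ| * N ^ γ) / N) + 1 / (s * √(|Δ| * N ^ γ) / N))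
      = 64 * (s * √(|Δ| * N ^ γ)) + 64 / s * (N / √(|Δ| * N ^ γ)) := by field_simp
    _ ≤ 64 * (1 / s * √(D₁ * N ^ γ)) + 64 / s * (N / √(D₀ * N ^ γ)) := by
        have : s ≤ 1 / s := hs1.trans (by rw [le_div_iff₀ hs0]; linarith)
        gcongr
    _ = _ := by ring

/-- Cauchy–Schwarz over `n` and over the values of `κ`, followed by expanding the square. -/
lemma norm_bilinear_sq_le {ι : Type*} (A : Finset ℕ) (P : Finset ι) (κ : ι → ℤ) (K : Finset ℤ)
    (hκ : ∀ p ∈ P, κ p ∈ K) (b : ℕ → ℂ) (hb : ∀ n ∈ A, ‖b n‖ ≤ 1) (F : ι → ℕ → ℂ) :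
    ‖∑ n ∈ A, b n * ∑ p ∈ P, F p n‖ ^ 2 ≤ #A * #K *
      ∑ p ∈ P, ∑ p' ∈ P.filter (fun p' => κ p' = κ p),
        ‖∑ n ∈ A, F p n * (starRingEnd ℂ) (F p' n)‖ := by
  set G : ℕ → ℤ → ℂ := fun n k => ∑ p ∈ P.filter (fun p => κ p = k), F p n with hG
  have h1 : ‖∑ n ∈ A, b n * ∑ p ∈ P, F p n‖ ≤ ∑ x ∈ A ×ˢ K, ‖G x.1 x.2‖ := by
    rw [sum_product]
    refine (norm_sum_le _ _).trans (sum_le_sum fun n hn => ?_)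
    rw [← sum_fiberwise_of_maps_to hκ, norm_mul]
    calc _ ≤ 1 * ‖∑ k ∈ K, G n k‖ := by gcongr; exact hb n hn
      _ ≤ _ := by rw [one_mul]; exact norm_sum_le _ _
  have h2 : (∑ x ∈ A ×ˢ K, ‖G x.1 x.2‖) ^ 2 ≤ #A * #K * ∑ x ∈ A ×ˢ K, ‖G x.1 x.2‖ ^ 2 := by
    have := sq_sum_le_card_mul_sum_sq (s := A ×ˢ K) (f := fun x => ‖G x.1 x.2‖)
    rw [card_product] at this
    exact_mod_cast this
  have h3 : ((∑ x ∈ A ×ˢ K, ‖G x.1 x.2‖ ^ 2 : ℝ) : ℂ) =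
      ∑ p ∈ P, ∑ p' ∈ P.filter (fun p' => κ p' = κ p),
        ∑ n ∈ A, F p n * (starRingEnd ℂ) (F p' n) := by
    rw [← sum_fiberwise_of_maps_to hκ, sum_product_right]
    push_cast
    refine sum_congr rfl fun k _ => ?_
    have : ∀ n ∈ A, ((‖G n k‖ : ℂ)) ^ 2 = ∑ p ∈ P.filter (fun p => κ p = k),
        ∑ p' ∈ P.filter (fun p' => κ p' = k), F p n * (starRingEnd ℂ) (F p' n) := by
      intro n _
      rw [← Complex.mul_conj', map_sum, sum_mul_sum]
    rw [sum_congr rfl this, sum_comm]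
    refine sum_congr rfl fun p hp => ?_
    rw [(mem_filter.1 hp).2, sum_comm]
  have h4 : ∑ x ∈ A ×ˢ K, ‖G x.1 x.2‖ ^ 2 ≤
      ∑ p ∈ P, ∑ p' ∈ P.filter (fun p' => κ p' = κ p),
        ‖∑ n ∈ A, F p n * (starRingEnd ℂ) (F p' n)‖ := by
    have h5 : (0 : ℝ) ≤ ∑ x ∈ A ×ˢ K, ‖G x.1 x.2‖ ^ 2 := sum_nonneg fun _ _ => by positivity
    rw [← Real.norm_of_nonneg h5, ← Complex.norm_real, h3]
    exact (norm_sum_le _ _).trans (sum_le_sum fun p _ => norm_sum_le _ _)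
  calc _ ≤ (∑ x ∈ A ×ˢ K, ‖G x.1 x.2‖) ^ 2 := by gcongr
    _ ≤ _ := h2
    _ ≤ _ := by gcongr

lemma mem_dyN {Y : ℝ} {m : ℕ} : m ∈ dyN Y ↔ Y / 2 ≤ (m : ℝ) ∧ (m : ℝ) < Y := by
  unfold dyN
  rw [mem_filter, mem_range, and_iff_right_iff_imp]
  rintro ⟨-, h⟩
  have : (m : ℝ) ≤ (⌈Y⌉₊ : ℝ) := h.le.trans (Nat.le_ceil Y)
  have : m ≤ ⌈Y⌉₊ := by exact_mod_cast this
  omega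

lemma dyZ_spec {Y : ℝ} {l : ℤ} (h : l ∈ dyZ Y) : l ≠ 0 ∧ Y / 2 ≤ |(l : ℝ)| ∧ |(l : ℝ)| < Y :=
  (mem_filter.1 h).2

lemma card_dyN_le {Y : ℝ} (hY : 1 ≤ Y) : (#(dyN Y) : ℝ) ≤ 2 * Y := by
  have := card_le_of_sub_le (dyN Y) (by linarith : (0 : ℝ) ≤ Y / 2) (by
    intro m hm n hn _
    rw [mem_dyN] at hm hn
    linarith)
  linarith

lemma card_dyZ_le {Y : ℝ} (hY : 1 ≤ Y) : (#(dyZ Y) : ℝ) ≤ 3 * Y := by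
  have hsub : dyZ Y ⊆ Icc (-⌊Y⌋) ⌊Y⌋ := by
    intro l hl
    have h := (abs_lt.1 (dyZ_spec hl).2.2)
    rw [mem_Icc]
    constructor
    · rw [neg_le, Int.le_floor]; push_cast; linarith
    · rw [Int.le_floor]; exact h.2.le
  have h1 := card_le_card hsub
  rw [Int.card_Icc] at h1
  have h0 : 0 ≤ ⌊Y⌋ := Int.floor_nonneg.2 (by linarith)
  have h2 : (#(dyZ Y) : ℤ) ≤ 2 * ⌊Y⌋ + 1 := by omega
  have h3 : ((#(dyZ Y) : ℤ) : ℝ) ≤ ((2 * ⌊Y⌋ + 1 : ℤ) : ℝ) := Int.cast_le.2 h2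
  push_cast at h3
  have := Int.floor_le Y
  linarith

lemma tangent_le_rpow {p x y : ℝ} (hp : 1 ≤ p) (hx : 0 < x) (hy : 0 < y) :
    y ^ p + p * y ^ (p - 1) * (x - y) ≤ x ^ p := by
  have h := one_add_mul_self_le_rpow_one_add (s := x / y - 1)
    (by have : 0 < x / y := by positivity
        linarith) hp
  have e1 : 1 + (x / y - 1) = x / y := by ring
  rw [e1, Real.div_rpow hx.le hy.le, le_div_iff₀ (by positivity)] at h
  rw [Real.rpow_sub_one hy.ne']
  refine le_of_eq_of_le ?_ h
  field_simp

lemma rpow_le_tangent {p x y : ℝ} (hp0 : 0 ≤ p) (hp : p ≤ 1) (hx : 0 < x) (hy : 0 < y) :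
    x ^ p ≤ y ^ p + p * y ^ (p - 1) * (x - y) := by
  have h := rpow_one_add_le_one_add_mul_self (s := x / y - 1)
    (by have : 0 < x / y := by positivity
        linarith) hp0 hp
  have e1 : 1 + (x / y - 1) = x / y := by ring
  rw [e1, Real.div_rpow hx.le hy.le, div_le_iff₀ (by positivity)] at h
  rw [Real.rpow_sub_one hy.ne']
  refine le_of_le_of_eq h ?_
  field_simp

lemma card_near_le {γ M V ε t : ℝ} (h0 : 1 / 2 ≤ γ) (h1 : γ < 1) (hM : 1 ≤ M) (hV : 1 ≤ V)
    (hε : 0 ≤ ε) {h : ℤ} (hh : h ∈ dyZ V) :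
    (#((dyN M).filter fun m : ℕ => |t - h * (m : ℝ) ^ γ| ≤ ε * V * M ^ γ) : ℝ) ≤ 8 * ε * M + 1 := by
  have hM0 : 0 < M := by linarith
  apply card_le_of_sub_le _ (by positivity)
  intro m hm n hn hmn
  rw [mem_filter, mem_dyN] at hm hn
  have hh1 := (dyZ_spec hh).2.1
  have hm0 : (0 : ℝ) < m := by linarith [hm.1.1]
  have hn0 : (0 : ℝ) < n := by linarith [hn.1.1]
  have hmn' : (m : ℝ) ≤ n := by exact_mod_cast hmn
  have ht := rpow_le_tangent (by linarith : 0 ≤ γ) h1.le hm0 hn0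
  have hpw : M ^ (γ - 1) ≤ (n : ℝ) ^ (γ - 1) :=
    Real.rpow_le_rpow_of_nonpos hn0 hn.1.2.le (by linarith)
  have hd : 1 / 2 * M ^ (γ - 1) * ((n : ℝ) - m) ≤ (n : ℝ) ^ γ - (m : ℝ) ^ γ := by
    have : 1 / 2 * M ^ (γ - 1) * ((n : ℝ) - m) ≤ γ * (n : ℝ) ^ (γ - 1) * ((n : ℝ) - m) := by
      have : (0 : ℝ) ≤ n - m := by linarith
      gcongr
    linarith
  have h3 : |(h : ℝ)| * ((n : ℝ) ^ γ - (m : ℝ) ^ γ) ≤ 2 * (ε * V * M ^ γ) := by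
    have : |(h : ℝ)| * ((n : ℝ) ^ γ - (m : ℝ) ^ γ) ≤ |h * ((n : ℝ) ^ γ - (m : ℝ) ^ γ)| := by
      rw [abs_mul]; gcongr; exact le_abs_self _
    have h4 : (h : ℝ) * ((n : ℝ) ^ γ - (m : ℝ) ^ γ) =
        (t - h * (m : ℝ) ^ γ) - (t - h * (n : ℝ) ^ γ) := by ring
    rw [h4] at this
    have := this.trans (abs_sub _ _)
    linarith [hm.2, hn.2]
  have hMp : M ^ γ = M ^ (γ - 1) * M := by
    rw [Real.rpow_sub_one hM0.ne']; field_simp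
  have hMpos : 0 < M ^ (γ - 1) := by positivity
  have h5 : V / 2 * (1 / 2 * M ^ (γ - 1) * ((n : ℝ) - m)) ≤ 2 * (ε * V * M ^ γ) := by
    have : 0 ≤ (n : ℝ) ^ γ - (m : ℝ) ^ γ :=
      le_trans (mul_nonneg (by positivity) (by linarith)) hd
    calc _ ≤ |(h : ℝ)| * ((n : ℝ) ^ γ - (m : ℝ) ^ γ) := by gcongr
      _ ≤ _ := h3
  rw [hMp] at h5
  have h6 : (V * M ^ (γ - 1)) * ((n : ℝ) - m) ≤ (V * M ^ (γ - 1)) * (8 * ε * M) := by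
    linarith
  exact le_of_mul_le_mul_left h6 (by positivity)

lemma approx_ratio {γ c M V ε : ℝ} (hγ : γ = 1 / c) (hc1 : 1 < c) (hc2 : c < 9 / 8)
    (hM : 1 ≤ M) (hε : 0 < ε) (hε1 : ε ≤ 1 / 8) {h h' : ℤ} (hh' : h' ∈ dyZ V)
    {m m' : ℕ} (hm : m ∈ dyN M) (hm' : m' ∈ dyN M)
    (hd : |h * (m : ℝ) ^ γ - h' * (m' : ℝ) ^ γ| ≤ ε * V * M ^ γ) :
    0 < (h : ℝ) / h' ∧ |(m' : ℝ) - ((h : ℝ) / h') ^ c * m| ≤ 8 * ε * M := by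
  have hM0 : 0 < M := by linarith
  have hc0 : 0 < c := by linarith
  have hγ0 : 0 < γ := by rw [hγ]; positivity
  have hγ1 : γ < 1 := by rw [hγ, div_lt_one hc0]; exact hc1
  have hγc : γ * c = 1 := by rw [hγ]; field_simp
  rw [mem_dyN] at hm hm'
  have hm0 : (0 : ℝ) < m := by linarith [hm.1]
  have hm0' : (0 : ℝ) < m' := by linarith [hm'.1]
  have hz := dyZ_spec hh'
  have hh0 : (h' : ℝ) ≠ 0 := by exact_mod_cast hz.1
  have hpos : 0 < |(h' : ℝ)| := abs_pos.2 hh0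
  have hMγ : 0 < M ^ γ := by positivity
  set r := (h : ℝ) / h' with hr
  have hd2 : |r * (m : ℝ) ^ γ - (m' : ℝ) ^ γ| ≤ 2 * ε * M ^ γ := by
    have e1 : h * (m : ℝ) ^ γ - h' * (m' : ℝ) ^ γ = h' * (r * (m : ℝ) ^ γ - (m' : ℝ) ^ γ) := by
      rw [hr]; field_simp
    rw [e1, abs_mul] at hd
    have h2 : |(h' : ℝ)| * |r * (m : ℝ) ^ γ - (m' : ℝ) ^ γ| ≤ |(h' : ℝ)| * (2 * ε * M ^ γ) := by
      refine hd.trans ?_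
      have : V ≤ 2 * |(h' : ℝ)| := by linarith [hz.2.1]
      calc ε * V * M ^ γ ≤ ε * (2 * |(h' : ℝ)|) * M ^ γ := by gcongr
        _ = _ := by ring
    exact le_of_mul_le_mul_left h2 hpos
  have hmlow : M ^ γ / 2 ≤ (m' : ℝ) ^ γ := by
    calc M ^ γ / 2 ≤ M ^ γ * (1 / 2 : ℝ) ^ γ := by
          have : (1 / 2 : ℝ) ^ (1 : ℝ) ≤ (1 / 2 : ℝ) ^ γ :=
            Real.rpow_le_rpow_of_exponent_ge (by norm_num) (by norm_num) hγ1.le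
          rw [Real.rpow_one] at this
          rw [div_eq_mul_one_div]; gcongr
      _ = (M * (1 / 2)) ^ γ := by rw [Real.mul_rpow hM0.le (by norm_num)]
      _ ≤ _ := Real.rpow_le_rpow (by positivity) (by linarith [hm'.1]) hγ0.le
  have hr0 : 0 < r := by
    by_contra hneg
    have h1 : r * (m : ℝ) ^ γ ≤ 0 :=
      mul_nonpos_of_nonpos_of_nonneg (not_lt.1 hneg) (by positivity)
    have h2 := (abs_le.1 hd2).1
    nlinarith
  refine ⟨hr0, ?_⟩
  set a := (m' : ℝ) ^ γ with ha
  set b := r * (m : ℝ) ^ γ with hb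
  have ha0 : 0 < a := by positivity
  have hb0 : 0 < b := by positivity
  have hac : a ^ c = m' := by rw [ha, ← Real.rpow_mul hm0'.le, hγc, Real.rpow_one]
  have hbc : b ^ c = r ^ c * m := by
    rw [hb, Real.mul_rpow hr0.le (by positivity), ← Real.rpow_mul hm0.le, hγc, Real.rpow_one]
  have haM : a ≤ M ^ γ := Real.rpow_le_rpow hm0'.le hm'.2.le hγ0.le
  have hbM : b ≤ 2 * M ^ γ := by
    have := (abs_le.1 hd2).2
    nlinarith
  have hY : ∀ x y : ℝ, 0 < x → 0 < y → y ≤ 2 * M ^ γ → |y - x| ≤ 2 * ε * M ^ γ →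
      y ^ c - x ^ c ≤ 8 * ε * M := by
    intro x y hx hy hyM hxy
    have h1 := tangent_le_rpow hc1.le hx hy
    have h2 : y ^ (c - 1) ≤ 2 * (M ^ γ) ^ (c - 1) := by
      calc y ^ (c - 1) ≤ (2 * M ^ γ) ^ (c - 1) := Real.rpow_le_rpow hy.le hyM (by linarith)
        _ = 2 ^ (c - 1) * (M ^ γ) ^ (c - 1) := by rw [Real.mul_rpow (by norm_num) hMγ.le]
        _ ≤ 2 * (M ^ γ) ^ (c - 1) := by
          have : (2 : ℝ) ^ (c - 1) ≤ 2 ^ (1 : ℝ) :=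
            Real.rpow_le_rpow_of_exponent_le (by norm_num) (by linarith)
          rw [Real.rpow_one] at this
          gcongr
    have h3 : (M ^ γ) ^ (c - 1) * M ^ γ = M := by
      rw [← Real.rpow_mul hM0.le, ← Real.rpow_add hM0]
      have : γ * (c - 1) + γ = 1 := by linear_combination hγc
      rw [this, Real.rpow_one]
    calc y ^ c - x ^ c ≤ c * y ^ (c - 1) * (y - x) := by linarith
      _ ≤ c * y ^ (c - 1) * |y - x| := by gcongr; exact le_abs_self _
      _ ≤ 2 * (2 * (M ^ γ) ^ (c - 1)) * (2 * ε * M ^ γ) := by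
          gcongr; linarith
      _ = 8 * ε * ((M ^ γ) ^ (c - 1) * M ^ γ) := by ring
      _ = 8 * ε * M := by rw [h3]
  rw [← hac, ← hbc, abs_le]
  have h5 := hY a b ha0 hb0 hbM hd2
  have h6 := hY b a hb0 ha0 (by linarith) (by rw [abs_sub_comm]; exact hd2)
  constructor <;> linarith

lemma card_le_of_gap {M : ℝ} (hM : 0 ≤ M) (S : Finset ℕ) {B : ℕ} (hB : 0 < B)
    (hS : ∀ m ∈ S, (m : ℝ) < M) (hgap : ∀ m ∈ S, ∀ n ∈ S, m < n → B ≤ n - m) :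
    (#S : ℝ) ≤ M / B + 1 := by
  have hB' : (0 : ℝ) < B := by exact_mod_cast hB
  have h1 : #S ≤ #(range (⌊M / B⌋₊ + 1)) := by
    apply card_le_card_of_injOn (fun m => m / B)
    · intro m hm
      have : ((m / B : ℕ) : ℝ) ≤ M / B :=
        Nat.cast_div_le.trans (div_le_div_of_nonneg_right (hS m hm).le hB'.le)
      simp only [coe_range, Set.mem_Iio]
      exact Nat.lt_succ_of_le (Nat.le_floor this)
    · intro m hm n hn hmn
      simp only at hmn
      have h1 := Nat.div_add_mod m B
      have h2 := Nat.div_add_mod n B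
      have h3 := Nat.mod_lt m hB
      have h4 := Nat.mod_lt n hB
      rw [hmn] at h1
      rcases lt_trichotomy m n with h | h | h
      · have := hgap m hm n hn h; omega
      · exact h
      · have := hgap n hn m hm h; omega
  rw [card_range] at h1
  have h2 : (#S : ℝ) ≤ (⌊M / B⌋₊ : ℝ) + 1 := by exact_mod_cast h1
  have := Nat.floor_le (by positivity : 0 ≤ M / B)
  linarith

/-- The `m ∼ M` for which `h m ^ γ` is close to `h' m' ^ γ` for some `m' ∼ M`. -/
noncomputable def nearSet (γ M D : ℝ) (h h' : ℤ) : Finset ℕ :=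
  (dyN M).filter fun m : ℕ => ∃ m' ∈ dyN M, |h * (m : ℝ) ^ γ - h' * (m' : ℝ) ^ γ| ≤ D

lemma ratio_rpow_separated {c V δ : ℝ} (hc1 : 1 < c) (hc2 : c < 9 / 8) (hδ : 2 * V * δ < 1)
    {h₁ h₂ h' : ℤ} (hh₂ : h₂ ∈ dyZ V) (hh' : h' ∈ dyZ V)
    (hpos₂ : 0 < (h₂ : ℝ) / h') (hlt : (h₂ : ℝ) / h' < (h₁ : ℝ) / h')
    (hd : ((h₁ : ℝ) / h') ^ c - ((h₂ : ℝ) / h') ^ c ≤ δ) : False := by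
  have hz := dyZ_spec hh'
  have hh0 : (h' : ℝ) ≠ 0 := by exact_mod_cast hz.1
  have hpos : 0 < |(h' : ℝ)| := abs_pos.2 hh0
  set x := (h₁ : ℝ) / h' with hx
  set y := (h₂ : ℝ) / h' with hy
  have hV : 0 < V := hpos.trans hz.2.2
  have hxy : 1 / V ≤ x - y := by
    have hne : h₁ - h₂ ≠ 0 := by
      intro h0
      have : h₁ = h₂ := by omega
      rw [hx, hy, this] at hlt
      exact lt_irrefl _ hlt
    have h1 : (1 : ℝ) ≤ |((h₁ - h₂ : ℤ) : ℝ)| := by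
      exact_mod_cast Int.one_le_abs hne
    have h2 : x - y = |((h₁ - h₂ : ℤ) : ℝ)| / |(h' : ℝ)| := by
      rw [← abs_div, ← abs_of_pos (sub_pos.2 hlt), hx, hy]
      push_cast
      rw [sub_div]
    rw [h2]
    exact div_le_div₀ (by linarith) h1 hpos hz.2.2.le
  have hyhalf : 1 / 2 ≤ y := by
    rw [← abs_of_pos hpos₂, hy, abs_div, le_div_iff₀ hpos]
    linarith [(dyZ_spec hh₂).2.1, hz.2.2]
  have ht := tangent_le_rpow hc1.le (hpos₂.trans hlt) hpos₂
  have hyc : 1 / 2 ≤ y ^ (c - 1) := by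
    calc (1 / 2 : ℝ) = (1 / 2) ^ (1 : ℝ) := by rw [Real.rpow_one]
      _ ≤ (1 / 2) ^ (c - 1) :=
        Real.rpow_le_rpow_of_exponent_ge (by norm_num) (by norm_num) (by linarith)
      _ ≤ y ^ (c - 1) := Real.rpow_le_rpow (by norm_num) hyhalf (by linarith)
  have h3 : 1 * (1 / 2) * (1 / V) ≤ c * y ^ (c - 1) * (x - y) := by gcongr
  have h4 : 1 / (2 * V) ≤ δ := by
    have : 1 * (1 / 2) * (1 / V) = 1 / (2 * V) := by field_simp
    linarith
  rw [div_le_iff₀ (by positivity)] at h4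
  linarith

open Classical in
lemma card_bad_le {γ c M V ε : ℝ} (hγ : γ = 1 / c) (hc1 : 1 < c) (hc2 : c < 9 / 8)
    (hM : 1 ≤ M) (hV : 1 ≤ V) (hε : 0 < ε) (hε1 : 64 * ε * M * V < 1) {B : ℕ} (hB : 1 ≤ B) :
    (#((dyZ V ×ˢ dyZ V).filter fun x : ℤ × ℤ => ∃ k ∈ Icc 1 B, ∃ m,
      m ∈ nearSet γ M (ε * V * M ^ γ) x.1 x.2 ∧ m + k ∈ nearSet γ M (ε * V * M ^ γ) x.1 x.2) : ℝ)
      ≤ 33 * V * B ^ 2 := by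
  have hM0 : 0 < M := by linarith
  have hεM : 64 * ε * M < 1 := by
    have : 0 < ε * M := by positivity
    nlinarith
  have hε8 : ε ≤ 1 / 8 := by nlinarith
  have hcard : #((dyZ V ×ˢ dyZ V).filter fun x : ℤ × ℤ => ∃ k ∈ Icc 1 B, ∃ m,
      m ∈ nearSet γ M (ε * V * M ^ γ) x.1 x.2 ∧ m + k ∈ nearSet γ M (ε * V * M ^ γ) x.1 x.2) ≤
      #(dyZ V ×ˢ (Icc 1 B ×ˢ Icc (-(5 * B : ℤ)) (5 * B))) := by
    apply card_le_card_of_forall_subsingleton (fun (x : ℤ × ℤ) (y : ℤ × ℕ × ℤ) => y.1 = x.2 ∧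
      0 < (x.1 : ℝ) / x.2 ∧ |(y.2.2 : ℝ) - ((x.1 : ℝ) / x.2) ^ c * y.2.1| ≤ 16 * ε * M)
    · rintro ⟨h, h'⟩ hx
      rw [mem_filter, mem_product] at hx
      obtain ⟨⟨hh, hh'⟩, k, hk, m, hm1, hm2⟩ := hx
      simp only at hh hh' hm1 hm2
      unfold nearSet at hm1 hm2
      rw [mem_filter] at hm1 hm2
      obtain ⟨hm1, m1', hm1', hd1⟩ := hm1
      obtain ⟨hm2, m2', hm2', hd2⟩ := hm2
      obtain ⟨hr, ha1⟩ := approx_ratio hγ hc1 hc2 hM hε hε8 hh' hm1 hm1' hd1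
      obtain ⟨-, ha2⟩ := approx_ratio hγ hc1 hc2 hM hε hε8 hh' hm2 hm2' hd2
      set ρ := ((h : ℝ) / h') ^ c with hρ
      have hρ0 : 0 < ρ := by positivity
      have hρ4 : ρ ≤ 4 := by
        have hz := dyZ_spec hh'
        have hh0 : (h' : ℝ) ≠ 0 := by exact_mod_cast hz.1
        have h2 : (h : ℝ) / h' ≤ 2 := by
          rw [← abs_of_pos hr, abs_div, div_le_iff₀ (abs_pos.2 hh0)]
          linarith [hz.2.1, (dyZ_spec hh).2.2]
        calc ρ ≤ 2 ^ c := Real.rpow_le_rpow hr.le h2 (by linarith)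
          _ ≤ 2 ^ (2 : ℝ) := Real.rpow_le_rpow_of_exponent_le (by norm_num) (by linarith)
          _ = 4 := by norm_num
      have hj : |(((m2' : ℤ) - m1' : ℤ) : ℝ) - ρ * k| ≤ 16 * ε * M := by
        push_cast at ha2 ⊢
        have e1 : (m2' : ℝ) - m1' - ρ * k = (m2' - ρ * (m + k)) - (m1' - ρ * m) := by ring
        rw [e1]
        exact (abs_sub _ _).trans (by linarith)
      refine ⟨(h', k, (m2' : ℤ) - m1'), ?_, rfl, hr, hj⟩
      rw [mem_product, mem_product]
      refine ⟨hh', hk, ?_⟩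
      rw [mem_Icc] at hk ⊢
      have hkB : (k : ℝ) ≤ B := by exact_mod_cast hk.2
      have hB1 : (1 : ℝ) ≤ B := by exact_mod_cast hB
      have hk0 : (0 : ℝ) ≤ k := Nat.cast_nonneg k
      have h5 := abs_le.1 hj
      have h6 : ρ * k ≤ 4 * B := by gcongr
      have h7 : 0 ≤ ρ * k := by positivity
      constructor
      · have : ((-(5 * B : ℤ) : ℤ) : ℝ) ≤ (((m2' : ℤ) - m1' : ℤ) : ℝ) := by
          push_cast at h5 ⊢; linarith [h5.1]
        exact_mod_cast this
      · have : (((m2' : ℤ) - m1' : ℤ) : ℝ) ≤ ((5 * B : ℤ) : ℝ) := by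
          push_cast at h5 ⊢; linarith [h5.2]
        exact_mod_cast this
    · rintro ⟨h', k, j⟩ hy
      rw [mem_product, mem_product, mem_Icc] at hy
      obtain ⟨hh', hk, -⟩ := hy
      simp only at hk
      have hk1 : (1 : ℝ) ≤ k := by exact_mod_cast hk.1
      have key : ∀ h₁ h₂ : ℤ, h₁ ∈ dyZ V → h₂ ∈ dyZ V → 0 < (h₁ : ℝ) / h' → 0 < (h₂ : ℝ) / h' →
          |(j : ℝ) - ((h₁ : ℝ) / h') ^ c * k| ≤ 16 * ε * M →
          |(j : ℝ) - ((h₂ : ℝ) / h') ^ c * k| ≤ 16 * ε * M →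
          ¬ (h₂ : ℝ) / h' < (h₁ : ℝ) / h' := by
        intro h₁ h₂ hh₁ hh₂ hp1 hp2 hd1 hd2 hlt
        refine ratio_rpow_separated (V := V) (δ := 32 * ε * M) hc1 hc2 (by linarith) hh₂ hh'
          hp2 hlt ?_
        have h1 := (abs_le.1 hd1).1
        have h2 := (abs_le.1 hd2).2
        have h3 : ((h₂ : ℝ) / h') ^ c ≤ ((h₁ : ℝ) / h') ^ c :=
          Real.rpow_le_rpow hp2.le hlt.le (by linarith)
        nlinarith
      rintro ⟨h₁, h₁'⟩ ⟨hx1, e1, hp1, hd1⟩ ⟨h₂, h₂'⟩ ⟨hx2, e2, hp2, hd2⟩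
      simp only at e1 e2 hp1 hp2 hd1 hd2
      subst e1
      subst e2
      rw [mem_filter, mem_product] at hx1 hx2
      have hh0 : (h' : ℝ) ≠ 0 := by exact_mod_cast (dyZ_spec hh').1
      have heq : (h₁ : ℝ) / h' = (h₂ : ℝ) / h' :=
        le_antisymm (not_lt.1 (key h₁ h₂ hx1.1.1 hx2.1.1 hp1 hp2 hd1 hd2))
          (not_lt.1 (key h₂ h₁ hx2.1.1 hx1.1.1 hp2 hp1 hd2 hd1))
      rw [div_left_inj' hh0] at heq
      have : h₁ = h₂ := by exact_mod_cast heq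
      rw [this]
  rw [card_product, card_product, Nat.card_Icc, Int.card_Icc] at hcard
  have e3 : (5 * (B : ℤ) + 1 - -(5 * (B : ℤ))).toNat ≤ 11 * B := by omega
  have e4 : #((dyZ V ×ˢ dyZ V).filter fun x : ℤ × ℤ => ∃ k ∈ Icc 1 B, ∃ m,
      m ∈ nearSet γ M (ε * V * M ^ γ) x.1 x.2 ∧ m + k ∈ nearSet γ M (ε * V * M ^ γ) x.1 x.2) ≤
      #(dyZ V) * (B * (11 * B)) := by
    refine hcard.trans ?_
    gcongr
    omega
  have e5 := (Nat.cast_le (α := ℝ)).2 e4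
  refine e5.trans ?_
  push_cast
  have := card_dyZ_le hV
  calc (#(dyZ V) : ℝ) * (B * (11 * B)) ≤ 3 * V * (B * (11 * B)) := by gcongr
    _ = _ := by ring

open Classical in
/-- The number of quadruples for which `h m ^ γ - h' m' ^ γ` is very small. -/
lemma card_near_pairs_le {γ c M V ε : ℝ} (hγ : γ = 1 / c) (hc1 : 1 < c) (hc2 : c < 9 / 8)
    (hM : 1 ≤ M) (hV : 1 ≤ V) (hε : 0 < ε) (hε1 : 64 * ε * M * V < 1) {B : ℕ} (hB : 1 ≤ B) :
    (∑ p ∈ dyN M ×ˢ dyZ V, ∑ p' ∈ dyN M ×ˢ dyZ V,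
      if |(p.2 : ℝ) * (p.1 : ℝ) ^ γ - p'.2 * (p'.1 : ℝ) ^ γ| ≤ ε * V * M ^ γ then (1 : ℝ) else 0)
      ≤ 66 * V * B ^ 2 * M + 9 * V ^ 2 * (M / B + 1) := by
  have hM0 : 0 < M := by linarith
  have hεM : 64 * ε * M < 1 := by
    have : 0 < ε * M := by positivity
    nlinarith
  have hγ1 : γ < 1 := by rw [hγ, div_lt_one (by linarith)]; exact hc1
  have hγ0 : 1 / 2 ≤ γ := by
    rw [hγ]; exact one_div_le_one_div_of_le (by linarith) (by linarith)
  set D := ε * V * M ^ γ with hD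
  have hT : ∀ h ∈ dyZ V, ∀ h' ∈ dyZ V, (∑ m ∈ dyN M, ∑ m' ∈ dyN M,
      if |(h : ℝ) * (m : ℝ) ^ γ - h' * (m' : ℝ) ^ γ| ≤ D then (1 : ℝ) else 0) ≤
      #(nearSet γ M D h h') := by
    intro h hh h' hh'
    have h1 : (#(nearSet γ M D h h') : ℝ) = ∑ m ∈ dyN M,
        if (∃ m' ∈ dyN M, |h * (m : ℝ) ^ γ - h' * (m' : ℝ) ^ γ| ≤ D) then (1 : ℝ) else 0 := by
      unfold nearSet
      rw [card_filter]; push_cast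
      rfl
    rw [h1]
    refine sum_le_sum fun m _ => ?_
    have h2 : (∑ m' ∈ dyN M,
        if |(h : ℝ) * (m : ℝ) ^ γ - h' * (m' : ℝ) ^ γ| ≤ D then (1 : ℝ) else 0) =
        #((dyN M).filter fun m' : ℕ => |(h : ℝ) * (m : ℝ) ^ γ - h' * (m' : ℝ) ^ γ| ≤ D) := by
      rw [card_filter]; push_cast; rfl
    rw [h2]
    split_ifs with hex
    · have h3 := card_near_le (t := h * (m : ℝ) ^ γ) hγ0 hγ1 hM hV hε.le hh'
      have h4 : (#((dyN M).filter fun m' : ℕ =>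
          |(h : ℝ) * (m : ℝ) ^ γ - h' * (m' : ℝ) ^ γ| ≤ D) : ℝ) < 2 := by
        refine h3.trans_lt ?_; linarith
      have h5 : #((dyN M).filter fun m' : ℕ =>
          |(h : ℝ) * (m : ℝ) ^ γ - h' * (m' : ℝ) ^ γ| ≤ D) < 2 := by exact_mod_cast h4
      exact_mod_cast Nat.le_of_lt_succ h5
    · rw [filter_eq_empty_iff.2]
      · simp
      · intro m' hm' hle
        exact hex ⟨m', hm', hle⟩
  have hre : (∑ p ∈ dyN M ×ˢ dyZ V, ∑ p' ∈ dyN M ×ˢ dyZ V,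
      if |(p.2 : ℝ) * (p.1 : ℝ) ^ γ - p'.2 * (p'.1 : ℝ) ^ γ| ≤ D then (1 : ℝ) else 0) =
      ∑ x ∈ dyZ V ×ˢ dyZ V, ∑ m ∈ dyN M, ∑ m' ∈ dyN M,
      if |(x.1 : ℝ) * (m : ℝ) ^ γ - x.2 * (m' : ℝ) ^ γ| ≤ D then (1 : ℝ) else 0 := by
    rw [sum_product_right, sum_product]
    refine sum_congr rfl fun h _ => ?_
    rw [sum_comm (s := dyZ V)]
    refine sum_congr rfl fun m _ => ?_
    rw [sum_product_right]
  rw [hre]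
  set bad : ℤ × ℤ → Prop := fun x => ∃ k ∈ Icc 1 B, ∃ m,
      m ∈ nearSet γ M D x.1 x.2 ∧ m + k ∈ nearSet γ M D x.1 x.2 with hbad
  have hpt : ∀ x ∈ dyZ V ×ˢ dyZ V, (∑ m ∈ dyN M, ∑ m' ∈ dyN M,
      if |(x.1 : ℝ) * (m : ℝ) ^ γ - x.2 * (m' : ℝ) ^ γ| ≤ D then (1 : ℝ) else 0) ≤
      (if bad x then 1 else 0) * (2 * M) + (M / B + 1) := by
    intro x hx
    rw [mem_product] at hx
    refine (hT x.1 hx.1 x.2 hx.2).trans ?_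
    split_ifs with hb
    · have h1 : (#(nearSet γ M D x.1 x.2) : ℝ) ≤ #(dyN M) := by
        exact_mod_cast card_le_card (filter_subset _ _)
      have := card_dyN_le hM
      have : 0 ≤ M / B := by positivity
      linarith
    · rw [zero_mul, zero_add]
      apply card_le_of_gap hM0.le _ hB
      · intro m hm
        exact (mem_dyN.1 (mem_filter.1 hm).1).2
      · intro m hm n hn hmn
        by_contra hlt
        exact hb ⟨n - m, mem_Icc.2 (by omega), m, hm, by rwa [Nat.add_sub_cancel' hmn.le]⟩
  refine (sum_le_sum hpt).trans ?_
  rw [sum_add_distrib, ← sum_mul, sum_const, card_product, nsmul_eq_mul]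
  have hb1 : (∑ x ∈ dyZ V ×ˢ dyZ V, if bad x then (1 : ℝ) else 0) ≤ 33 * V * B ^ 2 := by
    have := card_bad_le hγ hc1 hc2 hM hV hε hε1 hB
    rw [card_filter] at this
    push_cast at this
    exact this
  have hz := card_dyZ_le hV
  have hMB : 0 ≤ M / B + 1 := by positivity
  push_cast
  calc _ ≤ 33 * V * B ^ 2 * (2 * M) + (3 * V) * (3 * V) * (M / B + 1) := by gcongr
    _ = _ := by ring

/-- The summand of the bilinear form, cut off to `X / 2 ≤ m n < X`. -/
noncomputable def bilinTerm (γ X β : ℝ) (a : ℕ → ℂ) (d : ℤ → ℂ) (p : ℕ × ℤ) (n : ℕ) : ℂ :=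
  if X / 2 ≤ ((p.1 * n : ℕ) : ℝ) ∧ ((p.1 * n : ℕ) : ℝ) < X then
    a p.1 * d p.2 * e (β * p.1 * n + p.2 * ((p.1 : ℝ) * n) ^ γ) else 0

lemma norm_sum_bilinTerm_le {γ : ℝ} (h0 : 0 < γ) (h1 : γ < 1) {M N V : ℝ} (hN : 1 ≤ N)
    (X β : ℝ) (a : ℕ → ℂ) (d : ℤ → ℂ) (ha : ∀ m ∈ dyN M, ‖a m‖ ≤ 1)
    (hd : ∀ h ∈ dyZ V, ‖d h‖ ≤ 1) {p p' : ℕ × ℤ} (hp : p ∈ dyN M ×ˢ dyZ V)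
    (hp' : p' ∈ dyN M ×ˢ dyZ V) {D₀ D₁ : ℝ} (hD₀ : 0 < D₀)
    (hΔ : |(p.2 : ℝ) * (p.1 : ℝ) ^ γ - p'.2 * (p'.1 : ℝ) ^ γ| ≤ D₁) :
    ‖∑ n ∈ dyN N, bilinTerm γ X β a d p n * (starRingEnd ℂ) (bilinTerm γ X β a d p' n)‖ ≤
      2 * N * (if |(p.2 : ℝ) * (p.1 : ℝ) ^ γ - p'.2 * (p'.1 : ℝ) ^ γ| ≤ D₀ then 1 else 0) +
      64 / √(γ * (1 - γ)) * (√(D₁ * N ^ γ) + N / √(D₀ * N ^ γ)) := by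
  obtain ⟨m, h⟩ := p
  obtain ⟨m', h'⟩ := p'
  simp only at hΔ ⊢
  set Δ := (h : ℝ) * (m : ℝ) ^ γ - h' * (m' : ℝ) ^ γ with hΔdef
  rw [mem_product] at hp hp'
  set S := (dyN N).filter (fun n : ℕ => (X / 2 ≤ ((m * n : ℕ) : ℝ) ∧ ((m * n : ℕ) : ℝ) < X) ∧
    (X / 2 ≤ ((m' * n : ℕ) : ℝ) ∧ ((m' * n : ℕ) : ℝ) < X)) with hS
  have hsum : ∑ n ∈ dyN N,
      bilinTerm γ X β a d (m, h) n * (starRingEnd ℂ) (bilinTerm γ X β a d (m', h') n) =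
      (a m * d h * (starRingEnd ℂ) (a m' * d h')) *
        ∑ n ∈ S, e (β * ((m : ℝ) - m') * n + Δ * (n : ℝ) ^ γ) := by
    rw [hS, sum_filter, mul_sum]
    refine sum_congr rfl fun n _ => ?_
    simp only [bilinTerm]
    by_cases c1 : X / 2 ≤ ((m * n : ℕ) : ℝ) ∧ ((m * n : ℕ) : ℝ) < X
    · by_cases c2 : X / 2 ≤ ((m' * n : ℕ) : ℝ) ∧ ((m' * n : ℕ) : ℝ) < X
      · rw [if_pos c1, if_pos c2, if_pos ⟨c1, c2⟩, map_mul, conj_e]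
        have e1 : e (β * ((m : ℝ) - m') * n + Δ * (n : ℝ) ^ γ) =
            e (β * m * n + h * ((m : ℝ) * n) ^ γ) * e (-(β * m' * n + h' * ((m' : ℝ) * n) ^ γ)) := by
          rw [← e_add, Real.mul_rpow (Nat.cast_nonneg m) (Nat.cast_nonneg n),
            Real.mul_rpow (Nat.cast_nonneg m') (Nat.cast_nonneg n), hΔdef]
          congr 1; ring
        rw [e1]; ring
      · rw [if_neg c2, if_neg (fun hc : _ ∧ _ => c2 hc.2), map_zero, mul_zero, mul_zero]
    · rw [if_neg c1, if_neg (fun hc : _ ∧ _ => c1 hc.1), zero_mul, mul_zero]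
  have hw : ‖a m * d h * (starRingEnd ℂ) (a m' * d h')‖ ≤ 1 := by
    rw [norm_mul, Complex.norm_conj, norm_mul, norm_mul]
    have b1 := ha m hp.1
    have b2 := hd h hp.2
    have b3 := ha m' hp'.1
    have b4 := hd h' hp'.2
    exact mul_le_one₀ (mul_le_one₀ b1 (norm_nonneg _) b2) (by positivity)
      (mul_le_one₀ b3 (norm_nonneg _) b4)
  rw [hsum, norm_mul]
  refine (mul_le_of_le_one_left (norm_nonneg _) hw).trans ?_
  have hE : 0 ≤ 64 / √(γ * (1 - γ)) * (√(D₁ * N ^ γ) + N / √(D₀ * N ^ γ)) := by positivity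
  split_ifs with hle
  · have h2 : (#S : ℝ) ≤ #(dyN N) := by exact_mod_cast card_le_card (filter_subset _ _)
    have := norm_sum_e_le_card S (fun n => β * ((m : ℝ) - m') * n + Δ * (n : ℝ) ^ γ)
    have := card_dyN_le hN
    linarith
  · rw [mul_zero, zero_add]
    obtain ⟨u, v, huv⟩ := exists_eq_Ico_of_ordConnected S (by
      intro x hx z hz y hxy hyz
      rw [hS, mem_filter, mem_dyN] at hx hz ⊢
      have hxy' : (x : ℝ) ≤ y := by exact_mod_cast hxy
      have hyz' : (y : ℝ) ≤ z := by exact_mod_cast hyz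
      have g : ∀ k : ℕ, ((k * x : ℕ) : ℝ) ≤ ((k * y : ℕ) : ℝ) ∧
          ((k * y : ℕ) : ℝ) ≤ ((k * z : ℕ) : ℝ) := fun k =>
        ⟨by exact_mod_cast Nat.mul_le_mul_left k hxy, by exact_mod_cast Nat.mul_le_mul_left k hyz⟩
      exact ⟨⟨hx.1.1.trans hxy', hyz'.trans_lt hz.1.2⟩,
        ⟨hx.2.1.1.trans (g m).1, (g m).2.trans_lt hz.2.1.2⟩,
        ⟨hx.2.2.1.trans (g m').1, (g m').2.trans_lt hz.2.2.2⟩⟩)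
    rw [huv]
    refine norm_sum_e_linear_add_rpow_le h0 h1 hN _ hD₀ (not_le.1 hle).le hΔ u v ?_
    intro n hn
    rw [← huv] at hn
    exact mem_dyN.1 (mem_filter.1 hn).1

/-- The bilinear estimate for a fixed linear frequency `β`. -/
lemma bilinear_bound {γ c M N V Q ε : ℝ} (hγ : γ = 1 / c) (hc1 : 1 < c) (hc2 : c < 9 / 8)
    (hM : 1 ≤ M) (hN : 1 ≤ N) (hV : 1 ≤ V) (hQ : 1 ≤ Q) (hQM : Q ≤ M) (hε : 0 < ε)
    (hε1 : 64 * ε * M * V < 1) {B : ℕ} (hB : 1 ≤ B) (X β : ℝ) (a b : ℕ → ℂ) (d : ℤ → ℂ)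
    (ha : ∀ m ∈ dyN M, ‖a m‖ ≤ 1) (hb : ∀ n ∈ dyN N, ‖b n‖ ≤ 1) (hd : ∀ h ∈ dyZ V, ‖d h‖ ≤ 1) :
    ‖∑ n ∈ dyN N, b n * ∑ p ∈ dyN M ×ˢ dyZ V, bilinTerm γ X β a d p n‖ ^ 2 ≤
      2 * N * (4 * Q) * (2 * N * (66 * V * B ^ 2 * M + 9 * V ^ 2 * (M / B + 1)) +
        162 * V ^ 2 * M ^ 2 / Q * (64 / √(γ * (1 - γ)) *
          (√(V * M ^ γ / Q * N ^ γ) + N / √(ε * V * M ^ γ * N ^ γ)))) := by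
  have hM0 : 0 < M := by linarith
  have hV0 : 0 < V := by linarith
  have hQ0 : 0 < Q := by linarith
  have hγ1 : γ < 1 := by rw [hγ, div_lt_one (by linarith)]; exact hc1
  have hγ0 : 1 / 2 ≤ γ := by
    rw [hγ]; exact one_div_le_one_div_of_le (by linarith) (by linarith)
  have hγpos : 0 < γ := by linarith
  set P := dyN M ×ˢ dyZ V with hP
  set W := V * M ^ γ with hW
  have hW0 : 0 < W := by positivity
  set v : ℕ × ℤ → ℝ := fun p => (p.2 : ℝ) * (p.1 : ℝ) ^ γ with hv
  set κ : ℕ × ℤ → ℤ := fun p => ⌊v p * Q / W⌋ with hκdef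
  set E := 64 / √(γ * (1 - γ)) * (√(W / Q * N ^ γ) + N / √(ε * V * M ^ γ * N ^ γ)) with hE
  have hE0 : 0 ≤ E := by positivity
  have hκ : ∀ p ∈ P, κ p ∈ Icc ⌊-Q⌋ ⌊Q⌋ := by
    intro p hp
    rw [hP, mem_product, mem_dyN] at hp
    have h1 : |v p| ≤ W := by
      rw [hv, abs_mul, abs_of_nonneg (by positivity : 0 ≤ (p.1 : ℝ) ^ γ)]
      have h2 := (dyZ_spec hp.2).2.2.le
      have h3 := Real.rpow_le_rpow (Nat.cast_nonneg p.1) hp.1.2.le hγpos.le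
      exact mul_le_mul h2 h3 (by positivity) hV0.le
    have h2 : |v p * Q / W| ≤ Q := by
      rw [abs_div, abs_mul, abs_of_pos hQ0, abs_of_pos hW0, div_le_iff₀ hW0, mul_comm Q W]
      exact mul_le_mul_of_nonneg_right h1 hQ0.le
    have h3 := abs_le.1 h2
    rw [mem_Icc]
    exact ⟨Int.floor_le_floor h3.1, Int.floor_le_floor h3.2⟩
  have hK : (#(Icc ⌊-Q⌋ ⌊Q⌋) : ℝ) ≤ 4 * Q := by
    rw [Int.card_Icc]
    have h1 : ⌊-Q⌋ ≤ ⌊Q⌋ := Int.floor_le_floor (by linarith)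
    have h2 : (((⌊Q⌋ + 1 - ⌊-Q⌋).toNat : ℕ) : ℝ) = ((⌊Q⌋ + 1 - ⌊-Q⌋ : ℤ) : ℝ) := by
      rw [← Int.cast_natCast, Int.toNat_of_nonneg (by omega)]
    rw [h2]
    push_cast
    have := Int.floor_le Q
    have := Int.lt_floor_add_one (-Q)
    linarith
  have hclose : ∀ p p' : ℕ × ℤ, κ p' = κ p → |v p - v p'| ≤ W / Q := by
    intro p p' h
    have h1 := Int.abs_sub_lt_one_of_floor_eq_floor (h.symm : ⌊v p * Q / W⌋ = ⌊v p' * Q / W⌋)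
    rw [← sub_div, ← sub_mul, abs_div, abs_mul, abs_of_pos hQ0, abs_of_pos hW0,
      div_lt_one hW0] at h1
    rw [le_div_iff₀ hQ0]
    exact h1.le
  have hcount : ∀ p ∈ P, (#(P.filter fun p' => κ p' = κ p) : ℝ) ≤ 3 * V * (9 * M / Q) := by
    intro p _
    have h1 : (#(P.filter fun p' => κ p' = κ p) : ℝ) ≤
        ∑ h' ∈ dyZ V, (#((dyN M).filter fun m' : ℕ =>
          |v p - h' * (m' : ℝ) ^ γ| ≤ 1 / Q * V * M ^ γ) : ℝ) := by
      have : (#(P.filter fun p' => κ p' = κ p) : ℝ) ≤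
          #(P.filter fun p' => |v p - v p'| ≤ 1 / Q * V * M ^ γ) := by
        have hs : (P.filter fun p' => κ p' = κ p) ⊆
            P.filter fun p' => |v p - v p'| ≤ 1 / Q * V * M ^ γ := by
          intro p' hp'
          rw [mem_filter] at hp' ⊢
          refine ⟨hp'.1, (hclose p p' hp'.2).trans_eq ?_⟩
          rw [hW]; ring
        exact_mod_cast card_le_card hs
      refine this.trans (le_of_eq ?_)
      rw [card_filter, hP, sum_product_right]
      push_cast
      refine sum_congr rfl fun h' _ => ?_
      rw [card_filter]; push_cast; rfl
    refine h1.trans ?_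
    have h2 : ∀ h' ∈ dyZ V, (#((dyN M).filter fun m' : ℕ =>
          |v p - h' * (m' : ℝ) ^ γ| ≤ 1 / Q * V * M ^ γ) : ℝ) ≤ 9 * M / Q := by
      intro h' hh'
      refine (card_near_le hγ0 hγ1 hM hV (by positivity) hh').trans ?_
      have : 1 ≤ M / Q := by rw [le_div_iff₀ hQ0]; linarith
      have e1 : 8 * (1 / Q) * M = 8 * (M / Q) := by ring
      have e2 : 9 * M / Q = 9 * (M / Q) := by ring
      rw [e1, e2]; linarith
    refine (sum_le_sum h2).trans ?_
    rw [sum_const, nsmul_eq_mul]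
    have := card_dyZ_le hV
    gcongr
  refine (norm_bilinear_sq_le (dyN N) P κ _ hκ b hb _).trans ?_
  have hmain : ∑ p ∈ P, ∑ p' ∈ P.filter (fun p' => κ p' = κ p),
      ‖∑ n ∈ dyN N, bilinTerm γ X β a d p n * (starRingEnd ℂ) (bilinTerm γ X β a d p' n)‖ ≤
      2 * N * (66 * V * B ^ 2 * M + 9 * V ^ 2 * (M / B + 1)) + 162 * V ^ 2 * M ^ 2 / Q * E := by
    have h1 : ∀ p ∈ P, ∑ p' ∈ P.filter (fun p' => κ p' = κ p),
        ‖∑ n ∈ dyN N, bilinTerm γ X β a d p n * (starRingEnd ℂ) (bilinTerm γ X β a d p' n)‖ ≤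
        2 * N * (∑ p' ∈ P, if |(p.2 : ℝ) * (p.1 : ℝ) ^ γ - p'.2 * (p'.1 : ℝ) ^ γ| ≤
          ε * V * M ^ γ then (1 : ℝ) else 0) + 3 * V * (9 * M / Q) * E := by
      intro p hp
      have h2 : ∀ p' ∈ P.filter (fun p' => κ p' = κ p),
          ‖∑ n ∈ dyN N, bilinTerm γ X β a d p n *
            (starRingEnd ℂ) (bilinTerm γ X β a d p' n)‖ ≤
          2 * N * (if |(p.2 : ℝ) * (p.1 : ℝ) ^ γ - p'.2 * (p'.1 : ℝ) ^ γ| ≤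
          ε * V * M ^ γ then (1 : ℝ) else 0) + E := by
        intro p' hp'
        rw [mem_filter] at hp'
        exact norm_sum_bilinTerm_le hγpos hγ1 hN X β a d ha hd hp hp'.1 (by positivity)
          (hclose p p' hp'.2)
      refine (sum_le_sum h2).trans ?_
      rw [sum_add_distrib, ← mul_sum, sum_const, nsmul_eq_mul]
      have h3 := hcount p hp
      have h4 : ∑ p' ∈ P.filter (fun p' => κ p' = κ p),
          (if |(p.2 : ℝ) * (p.1 : ℝ) ^ γ - p'.2 * (p'.1 : ℝ) ^ γ| ≤
          ε * V * M ^ γ then (1 : ℝ) else 0) ≤ ∑ p' ∈ P,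
          (if |(p.2 : ℝ) * (p.1 : ℝ) ^ γ - p'.2 * (p'.1 : ℝ) ^ γ| ≤
          ε * V * M ^ γ then (1 : ℝ) else 0) :=
        sum_le_sum_of_subset_of_nonneg (filter_subset _ _) fun _ _ _ => by positivity
      gcongr
    refine (sum_le_sum h1).trans ?_
    rw [sum_add_distrib, ← mul_sum, sum_const, nsmul_eq_mul]
    have h5 := card_near_pairs_le hγ hc1 hc2 hM hV hε hε1 hB
    have h6 : (#P : ℝ) ≤ 2 * M * (3 * V) := by
      rw [hP, card_product]; push_cast
      have := card_dyN_le hM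
      have := card_dyZ_le hV
      gcongr
    calc _ ≤ 2 * N * (66 * V * B ^ 2 * M + 9 * V ^ 2 * (M / B + 1)) +
          2 * M * (3 * V) * (3 * V * (9 * M / Q) * E) := by
          refine add_le_add (mul_le_mul_of_nonneg_left h5 (by positivity)) ?_
          gcongr
      _ = _ := by ring
  have hA := card_dyN_le hN
  have h0 : 0 ≤ ∑ p ∈ P, ∑ p' ∈ P.filter (fun p' => κ p' = κ p),
      ‖∑ n ∈ dyN N, bilinTerm γ X β a d p n * (starRingEnd ℂ) (bilinTerm γ X β a d p' n)‖ :=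
    sum_nonneg fun _ _ => sum_nonneg fun _ _ => norm_nonneg _
  gcongr

/-- The size of the right-hand side of `bilinear_bound`, expressed through powers of `x`. -/
lemma bilinear_bound_size {x γ u v f s μ e₀ τ M N U V B G : ℝ} (hx : 1 ≤ x) (hγ0 : 0 < γ)
    (hγ1 : γ < 1) (hM : M = x ^ μ) (hN0 : x ^ (1 - μ) / 2 ≤ N) (hN : N ≤ 4 * x ^ (1 - μ))
    (hU0 : 0 ≤ U) (hU : U ≤ x ^ u) (hV0 : 0 < V) (hV : V ≤ 12 * x ^ v) (hB0 : 0 ≤ B)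
    (hB : B ≤ 2 * x ^ f) (hMB : M / B + 1 ≤ 2 * x ^ (μ - f)) (hG : 0 ≤ G)
    (h1 : 2 * u - s + v + 2 * f ≤ -τ) (h2 : 2 * u - s + 2 * v - f ≤ -τ)
    (h3 : 1 + 2 * u + 2 * v + μ + (v + γ - μ + s) / 2 ≤ 2 - τ)
    (h4 : 2 * u + 3 / 2 * v - (e₀ + γ) / 2 ≤ -τ) :
    U ^ 2 * (2 * N * (4 * x ^ (μ - s)) * (2 * N * (66 * V * B ^ 2 * M + 9 * V ^ 2 * (M / B + 1)) +
      162 * V ^ 2 * M ^ 2 / x ^ (μ - s) * (G *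
        (√(V * M ^ γ / x ^ (μ - s) * N ^ γ) + N / √(x ^ e₀ * V * M ^ γ * N ^ γ))))) ≤
    (1474560 + 7216128 * G) * x ^ (2 - τ) := by
  have hx0 : 0 < x := by linarith
  have hM0 : 0 < M := by rw [hM]; positivity
  have hNp : 0 < N := lt_of_lt_of_le (by positivity) hN0
  have hMγ : M ^ γ = x ^ (μ * γ) := by rw [hM, ← Real.rpow_mul hx0.le]
  have hxN : (x ^ (1 - μ)) ^ γ = x ^ ((1 - μ) * γ) := by rw [← Real.rpow_mul hx0.le]
  have hNγ : N ^ γ ≤ 4 * x ^ ((1 - μ) * γ) := by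
    calc N ^ γ ≤ (4 * x ^ (1 - μ)) ^ γ := Real.rpow_le_rpow hNp.le hN hγ0.le
      _ = 4 ^ γ * x ^ ((1 - μ) * γ) := by
        rw [Real.mul_rpow (by norm_num) (by positivity), hxN]
      _ ≤ _ := by
        gcongr
        calc (4 : ℝ) ^ γ ≤ 4 ^ (1 : ℝ) := Real.rpow_le_rpow_of_exponent_le (by norm_num) hγ1.le
          _ = 4 := Real.rpow_one 4
  have hNγ0 : 1 / 2 * x ^ ((1 - μ) * γ) ≤ N ^ γ := by
    calc 1 / 2 * x ^ ((1 - μ) * γ) ≤ (1 / 2) ^ γ * x ^ ((1 - μ) * γ) := by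
          gcongr
          calc (1 / 2 : ℝ) = (1 / 2) ^ (1 : ℝ) := (Real.rpow_one _).symm
            _ ≤ (1 / 2) ^ γ :=
              Real.rpow_le_rpow_of_exponent_ge (by norm_num) (by norm_num) hγ1.le
      _ = (1 / 2 * x ^ (1 - μ)) ^ γ := by
        rw [Real.mul_rpow (by norm_num) (by positivity), hxN]
      _ ≤ N ^ γ := Real.rpow_le_rpow (by positivity) (by linarith) hγ0.le
  have hS2 : √(V * M ^ γ / x ^ (μ - s) * N ^ γ) ≤ 7 * x ^ ((v + γ - μ + s) / 2) := by
    rw [Real.sqrt_le_left (by positivity), hMγ]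
    have e1 : (7 * x ^ ((v + γ - μ + s) / 2)) ^ 2 = 49 * (x ^ v * x ^ (μ * γ) / x ^ (μ - s) *
        x ^ ((1 - μ) * γ)) := by
      rw [← Real.rpow_add hx0, ← Real.rpow_sub hx0, ← Real.rpow_add hx0, mul_pow,
        ← Real.rpow_mul_natCast hx0.le]
      norm_num
      ring_nf
    rw [e1]
    calc V * x ^ (μ * γ) / x ^ (μ - s) * N ^ γ
        ≤ 12 * x ^ v * x ^ (μ * γ) / x ^ (μ - s) * (4 * x ^ ((1 - μ) * γ)) := by gcongr
      _ = 48 * (x ^ v * x ^ (μ * γ) / x ^ (μ - s) * x ^ ((1 - μ) * γ)) := by ring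
      _ ≤ _ := by gcongr; norm_num
  have hS3 : √V * (1 / 2 * x ^ ((e₀ + γ) / 2)) ≤ √(x ^ e₀ * V * M ^ γ * N ^ γ) := by
    apply Real.le_sqrt_of_sq_le
    rw [mul_pow, Real.sq_sqrt hV0.le, hMγ, mul_pow, ← Real.rpow_mul_natCast hx0.le]
    have e1 : x ^ ((e₀ + γ) / 2 * (2 : ℕ)) = x ^ e₀ * x ^ (μ * γ) * x ^ ((1 - μ) * γ) := by
      rw [← Real.rpow_add hx0, ← Real.rpow_add hx0]
      push_cast
      ring_nf
    rw [e1]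
    calc V * ((1 / 2) ^ 2 * (x ^ e₀ * x ^ (μ * γ) * x ^ ((1 - μ) * γ)))
        = 1 / 2 * (x ^ e₀ * V * x ^ (μ * γ) * (1 / 2 * x ^ ((1 - μ) * γ))) := by ring
      _ ≤ 1 / 2 * (x ^ e₀ * V * x ^ (μ * γ) * N ^ γ) := by gcongr
      _ ≤ _ := by
        have : 0 ≤ x ^ e₀ * V * x ^ (μ * γ) * N ^ γ := by positivity
        linarith
  have hsV : √V ≤ 4 * x ^ (v / 2) := by
    rw [Real.sqrt_le_left (by positivity), mul_pow, ← Real.rpow_mul_natCast hx0.le]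
    have : v / 2 * (2 : ℕ) = v := by push_cast; ring
    rw [this]
    have : 0 < x ^ v := by positivity
    linarith
  have hVS : V ^ 2 / √(x ^ e₀ * V * M ^ γ * N ^ γ) ≤
      96 * (x ^ v * x ^ (v / 2) * x ^ (-((e₀ + γ) / 2))) := by
    have hsV0 : 0 < √V := Real.sqrt_pos.2 hV0
    calc V ^ 2 / √(x ^ e₀ * V * M ^ γ * N ^ γ)
        ≤ V ^ 2 / (√V * (1 / 2 * x ^ ((e₀ + γ) / 2))) := by gcongr
      _ = 2 * (V * √V * x ^ (-((e₀ + γ) / 2))) := by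
        rw [Real.rpow_neg hx0.le]
        field_simp
        rw [Real.sq_sqrt hV0.le]
      _ ≤ 2 * (12 * x ^ v * (4 * x ^ (v / 2)) * x ^ (-((e₀ + γ) / 2))) := by gcongr
      _ = _ := by ring
  have hpow : ∀ {r : ℝ}, r ≤ 2 - τ → x ^ r ≤ x ^ (2 - τ) := fun h =>
    Real.rpow_le_rpow_of_exponent_le hx h
  have hT1 : U ^ 2 * N ^ 2 * x ^ (μ - s) * V * B ^ 2 * M ≤ 768 * x ^ (2 - τ) := by
    calc U ^ 2 * N ^ 2 * x ^ (μ - s) * V * B ^ 2 * M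
        ≤ (x ^ u) ^ 2 * (4 * x ^ (1 - μ)) ^ 2 * x ^ (μ - s) * (12 * x ^ v) * (2 * x ^ f) ^ 2 *
          x ^ μ := by
          rw [hM]; gcongr
      _ = 768 * x ^ (u + u + (1 - μ) + (1 - μ) + (μ - s) + v + f + f + μ) := by
        rw [Real.rpow_add hx0, Real.rpow_add hx0, Real.rpow_add hx0, Real.rpow_add hx0,
          Real.rpow_add hx0, Real.rpow_add hx0, Real.rpow_add hx0, Real.rpow_add hx0]
        ring
      _ ≤ _ := mul_le_mul_of_nonneg_left (hpow (by linarith)) (by norm_num)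
  have hT1' : U ^ 2 * N ^ 2 * x ^ (μ - s) * V ^ 2 * (M / B + 1) ≤ 4608 * x ^ (2 - τ) := by
    calc U ^ 2 * N ^ 2 * x ^ (μ - s) * V ^ 2 * (M / B + 1)
        ≤ (x ^ u) ^ 2 * (4 * x ^ (1 - μ)) ^ 2 * x ^ (μ - s) * (12 * x ^ v) ^ 2 *
          (2 * x ^ (μ - f)) := by gcongr
      _ = 4608 * x ^ (u + u + (1 - μ) + (1 - μ) + (μ - s) + v + v + (μ - f)) := by
        rw [Real.rpow_add hx0, Real.rpow_add hx0, Real.rpow_add hx0, Real.rpow_add hx0,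
          Real.rpow_add hx0, Real.rpow_add hx0, Real.rpow_add hx0]
        ring
      _ ≤ _ := mul_le_mul_of_nonneg_left (hpow (by linarith)) (by norm_num)
  have hT2 : U ^ 2 * N * V ^ 2 * M ^ 2 * √(V * M ^ γ / x ^ (μ - s) * N ^ γ) ≤
      4032 * x ^ (2 - τ) := by
    calc U ^ 2 * N * V ^ 2 * M ^ 2 * √(V * M ^ γ / x ^ (μ - s) * N ^ γ)
        ≤ (x ^ u) ^ 2 * (4 * x ^ (1 - μ)) * (12 * x ^ v) ^ 2 * (x ^ μ) ^ 2 *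
          (7 * x ^ ((v + γ - μ + s) / 2)) := by
          rw [← hM]; gcongr
      _ = 4032 * x ^ (u + u + (1 - μ) + v + v + μ + μ + (v + γ - μ + s) / 2) := by
        rw [Real.rpow_add hx0, Real.rpow_add hx0, Real.rpow_add hx0, Real.rpow_add hx0,
          Real.rpow_add hx0, Real.rpow_add hx0, Real.rpow_add hx0]
        ring
      _ ≤ _ := mul_le_mul_of_nonneg_left (hpow (by linarith)) (by norm_num)
  have hT3 : U ^ 2 * N ^ 2 * M ^ 2 * (V ^ 2 / √(x ^ e₀ * V * M ^ γ * N ^ γ)) ≤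
      1536 * x ^ (2 - τ) := by
    calc U ^ 2 * N ^ 2 * M ^ 2 * (V ^ 2 / √(x ^ e₀ * V * M ^ γ * N ^ γ))
        ≤ (x ^ u) ^ 2 * (4 * x ^ (1 - μ)) ^ 2 * (x ^ μ) ^ 2 *
          (96 * (x ^ v * x ^ (v / 2) * x ^ (-((e₀ + γ) / 2)))) := by
          rw [← hM]; gcongr
      _ = 1536 * x ^ (u + u + (1 - μ) + (1 - μ) + μ + μ + v + v / 2 + -((e₀ + γ) / 2)) := by
        rw [Real.rpow_add hx0, Real.rpow_add hx0, Real.rpow_add hx0, Real.rpow_add hx0,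
          Real.rpow_add hx0, Real.rpow_add hx0, Real.rpow_add hx0, Real.rpow_add hx0]
        ring
      _ ≤ _ := mul_le_mul_of_nonneg_left (hpow (by linarith)) (by norm_num)
  have hQ0 : 0 < x ^ (μ - s) := by positivity
  calc _ = 1056 * (U ^ 2 * N ^ 2 * x ^ (μ - s) * V * B ^ 2 * M) +
        144 * (U ^ 2 * N ^ 2 * x ^ (μ - s) * V ^ 2 * (M / B + 1)) +
        1296 * G * (U ^ 2 * N * V ^ 2 * M ^ 2 * √(V * M ^ γ / x ^ (μ - s) * N ^ γ) +
          U ^ 2 * N ^ 2 * M ^ 2 * (V ^ 2 / √(x ^ e₀ * V * M ^ γ * N ^ γ))) := by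
        generalize √(V * M ^ γ / x ^ (μ - s) * N ^ γ) = S
        generalize √(x ^ e₀ * V * M ^ γ * N ^ γ) = S'
        generalize M / B + 1 = K
        generalize x ^ (μ - s) = Q at hQ0
        have : (2 * N * (4 * Q)) * (162 * V ^ 2 * M ^ 2 / Q) = 1296 * N * V ^ 2 * M ^ 2 := by
          field_simp
          norm_num
        linear_combination U ^ 2 * (G * (S + N / S')) * this
    _ ≤ 1056 * (768 * x ^ (2 - τ)) + 144 * (4608 * x ^ (2 - τ)) +
        1296 * G * (4032 * x ^ (2 - τ) + 1536 * x ^ (2 - τ)) := by gcongr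
    _ = _ := by ring

lemma norm_quadrilinear_le {γ X M N U V α R : ℝ} (hU : 1 ≤ U) (am bn : ℕ → ℂ) (cl dh : ℤ → ℂ)
    (hc : ∀ l ∈ dyZ U, ‖cl l‖ ≤ 1) (hR : ∀ l ∈ dyZ U, ‖∑ n ∈ dyN N, bn n *
      ∑ p ∈ dyN M ×ˢ dyZ V, bilinTerm γ X (α * l) am dh p n‖ ≤ R) :
    ‖∑ m ∈ dyN M, ∑ n ∈ (dyN N).filter (fun n => X/2 ≤ ((m*n:ℕ):ℝ) ∧ ((m*n:ℕ):ℝ) < X),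
        ∑ l ∈ dyZ U, ∑ h ∈ dyZ V, am m * bn n * cl l * dh h *
          e (α * (l:ℝ) * (m:ℝ) * (n:ℝ) + (h:ℝ) * ((m:ℝ)*(n:ℝ))^γ)‖ ^ 2 ≤ 9 * (U ^ 2 * R ^ 2) := by
  have key : ∑ m ∈ dyN M, ∑ n ∈ (dyN N).filter
        (fun n => X/2 ≤ ((m*n:ℕ):ℝ) ∧ ((m*n:ℕ):ℝ) < X),
        ∑ l ∈ dyZ U, ∑ h ∈ dyZ V, am m * bn n * cl l * dh h *
          e (α * (l:ℝ) * (m:ℝ) * (n:ℝ) + (h:ℝ) * ((m:ℝ)*(n:ℝ))^γ) =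
      ∑ l ∈ dyZ U, cl l * ∑ n ∈ dyN N, bn n *
        ∑ p ∈ dyN M ×ˢ dyZ V, bilinTerm γ X (α * l) am dh p n := by
    calc _ = ∑ m ∈ dyN M, ∑ n ∈ dyN N, ∑ l ∈ dyZ U, ∑ h ∈ dyZ V,
          cl l * (bn n * bilinTerm γ X (α * l) am dh (m, h) n) := by
          refine sum_congr rfl fun m _ => ?_
          rw [sum_filter]
          refine sum_congr rfl fun n _ => ?_
          simp only [bilinTerm]
          split_ifs
          · refine sum_congr rfl fun l _ => sum_congr rfl fun h _ => ?_
            ring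
          · simp
      _ = ∑ l ∈ dyZ U, ∑ n ∈ dyN N, ∑ m ∈ dyN M, ∑ h ∈ dyZ V,
          cl l * (bn n * bilinTerm γ X (α * l) am dh (m, h) n) := by
          rw [sum_comm]
          simp_rw [sum_comm (s := dyN M) (t := dyZ U)]
          rw [sum_comm]
      _ = _ := by
          refine sum_congr rfl fun l _ => ?_
          rw [mul_sum]
          refine sum_congr rfl fun n _ => ?_
          rw [sum_product, mul_sum, mul_sum]
          refine sum_congr rfl fun m _ => ?_
          rw [mul_sum, mul_sum]
  have hle : ‖∑ l ∈ dyZ U, cl l * ∑ n ∈ dyN N, bn n *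
        ∑ p ∈ dyN M ×ˢ dyZ V, bilinTerm γ X (α * l) am dh p n‖ ≤ #(dyZ U) * R := by
    rw [← nsmul_eq_mul, ← sum_const]
    refine (norm_sum_le _ _).trans (sum_le_sum fun l hl => ?_)
    rw [norm_mul]
    exact (mul_le_of_le_one_left (norm_nonneg _) (hc l hl)).trans (hR l hl)
  rw [key]
  calc _ ≤ (#(dyZ U) * R) ^ 2 := pow_le_pow_left₀ (norm_nonneg _) hle 2
    _ = (#(dyZ U) : ℝ) ^ 2 * R ^ 2 := mul_pow _ _ 2
    _ ≤ (3 * U) ^ 2 * R ^ 2 := by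
      have := card_dyZ_le hU
      gcongr
    _ = _ := by ring

theorem T3_bound (c γ θ : ℝ) (hc1 : 1 < c) (hc2 : c < 9/8) (hγ : γ = 1/c)
    (hθ1 : 0 < θ) (hθ2 : θ < (9*γ - 8)/10) :
    ∃ η > (0:ℝ), ∃ C > (0:ℝ), ∃ X₀ > (0:ℝ), ∀ X : ℕ, X₀ ≤ (X:ℝ) → ∀ α : ℝ,
    ∀ M N U V : ℝ, 1 ≤ M → 1 ≤ N → 1 ≤ U → 1 ≤ V →
    (X:ℝ)^((7:ℝ)/22) ≤ M → M ≤ (X:ℝ)^((8:ℝ)/22) →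
    (X:ℝ)/(2*M) ≤ N → N ≤ 4*(X:ℝ)/M → U ≤ (⌊(X:ℝ)^(θ+η)⌋₊ : ℝ) → V ≤ (⌊10 * (X:ℝ)^(1-γ+η) / γ⌋₊ : ℝ) →
    ∀ am bn : ℕ → ℂ, ∀ cl dh : ℤ → ℂ,
    (∀ m ∈ dyN M, ‖am m‖ ≤ 1) → (∀ n ∈ dyN N, ‖bn n‖ ≤ 1) →
    (∀ l ∈ dyZ U, ‖cl l‖ ≤ 1) → (∀ h ∈ dyZ V, ‖dh h‖ ≤ 1) →
    ‖∑ m ∈ dyN M, ∑ n ∈ (dyN N).filter (fun n => (X:ℝ)/2 ≤ ((m*n:ℕ):ℝ) ∧ ((m*n:ℕ):ℝ) < (X:ℝ)),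
        ∑ l ∈ dyZ U, ∑ h ∈ dyZ V, am m * bn n * cl l * dh h *
          e (α * (l:ℝ) * (m:ℝ) * (n:ℝ) + (h:ℝ) * ((m:ℝ)*(n:ℝ))^γ)‖ ≤ C * (X:ℝ)^(1-2*η) := by
  have hγlt : γ < 1 := by rw [hγ, div_lt_one (by linarith)]; exact hc1
  have hγgt : 8 / 9 < γ := by linarith
  have hγ0 : 0 < γ := by linarith
  set G := 64 / √(γ * (1 - γ)) with hG
  have hG0 : 0 ≤ G := by positivity
  set η : ℝ := 1 / 10000 with hη
  set κ : ℝ := 7 / 11 - 17 * η - 4 * θ - 5 * (1 - γ) with hκ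
  have hκ0 : 0 < κ := by rw [hκ, hη]; linarith
  refine ⟨η, by positivity, √(9 * (1474560 + 7216128 * G)), by positivity,
    (769 : ℝ) ^ (1 / κ), by positivity, ?_⟩
  intro X hX α M N U V hM1 hN1 hU1 hV1 hMl hMu hNl hNu hUu hVu am bn cl dh ha hb hc hd
  set x : ℝ := (X : ℝ) with hxdef
  have hx1 : 1 < x := lt_of_lt_of_le (Real.one_lt_rpow (by norm_num) (by positivity)) hX
  have hx0 : 0 < x := by linarith
  have hxκ : 769 ≤ x ^ κ := by
    calc (769 : ℝ) = (769 ^ (1 / κ)) ^ κ := by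
          rw [← Real.rpow_mul (by norm_num), one_div_mul_cancel hκ0.ne', Real.rpow_one]
      _ ≤ x ^ κ := Real.rpow_le_rpow (by positivity) hX hκ0.le
  obtain ⟨μ, hμ⟩ : ∃ μ : ℝ, M = x ^ μ :=
    ⟨Real.logb x M, (Real.rpow_logb hx0 hx1.ne' (by linarith)).symm⟩
  have hμ1 : 7 / 22 ≤ μ := by rwa [hμ, Real.rpow_le_rpow_left_iff hx1] at hMl
  have hμ2 : μ ≤ 8 / 22 := by rwa [hμ, Real.rpow_le_rpow_left_iff hx1] at hMu
  have hxμ : x ^ (1 - μ) = x / M := by rw [Real.rpow_sub hx0, Real.rpow_one, hμ]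
  have hN0 : x ^ (1 - μ) / 2 ≤ N := by
    rw [hxμ, div_div, mul_comm M 2]; exact hNl
  have hN4 : N ≤ 4 * x ^ (1 - μ) := by
    rw [hxμ, ← mul_div_assoc]; exact hNu
  have hU : U ≤ x ^ (θ + η) := hUu.trans (Nat.floor_le (by positivity))
  have hV : V ≤ 12 * x ^ (1 - γ + η) := by
    refine (hVu.trans (Nat.floor_le (by positivity))).trans ?_
    rw [div_le_iff₀ hγ0]
    have : 0 < x ^ (1 - γ + η) := by positivity
    nlinarith
  set f : ℝ := (1 - γ) / 3 with hf
  set s : ℝ := 5 * (1 - γ) / 3 + 2 * θ + 8 * η with hs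
  set e₀ : ℝ := 4 * θ + 4 * (1 - γ) - 1 + 16 * η with he₀
  set B : ℕ := ⌈x ^ f⌉₊ with hB
  have hf1 : 1 ≤ x ^ f := Real.one_le_rpow hx1.le (by rw [hf]; linarith)
  have hBl : x ^ f ≤ B := Nat.le_ceil _
  have hBu : (B : ℝ) ≤ 2 * x ^ f := by
    have := Nat.ceil_lt_add_one (by positivity : 0 ≤ x ^ f)
    rw [hB]; linarith
  have hMB : M / B + 1 ≤ 2 * x ^ (μ - f) := by
    have h1 : M / B ≤ x ^ (μ - f) := by
      rw [Real.rpow_sub hx0, hμ]; gcongr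
    have h2 : 1 ≤ x ^ (μ - f) := Real.one_le_rpow hx1.le (by rw [hf]; linarith)
    linarith
  have hQ1 : 1 ≤ x ^ (μ - s) := Real.one_le_rpow hx1.le (by rw [hs, hη]; linarith)
  have hQM : x ^ (μ - s) ≤ M := by
    rw [hμ]; exact Real.rpow_le_rpow_of_exponent_le hx1.le (by rw [hs, hη]; linarith)
  have hε1 : 64 * x ^ e₀ * M * V < 1 := by
    calc 64 * x ^ e₀ * M * V
        ≤ 64 * x ^ e₀ * x ^ ((8 : ℝ) / 22) * (12 * x ^ (1 - γ + η)) := by gcongr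
      _ = 768 * x ^ (-κ) := by
        have : -κ = e₀ + 8 / 22 + (1 - γ + η) := by rw [hκ, he₀]; ring
        rw [this, Real.rpow_add hx0 (e₀ + 8 / 22), Real.rpow_add hx0 e₀]; ring
      _ < 1 := by
        rw [Real.rpow_neg hx0.le, ← div_eq_mul_inv, div_lt_one (by positivity)]
        linarith
  have hsize := bilinear_bound_size (u := θ + η) (v := 1 - γ + η) (f := f) (s := s) (e₀ := e₀)
    (τ := 4 * η) hx1.le hγ0 hγlt hμ hN0 hN4 (by linarith) hU (by linarith) hV (Nat.cast_nonneg B)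
    hBu hMB hG0 (by rw [hs, hf, hη]; linarith) (by rw [hs, hf, hη]; linarith)
    (by rw [hs, hη]; linarith) (by rw [he₀, hη]; linarith)
  refine le_of_abs_le (abs_le_of_sq_le_sq ?_ ?_)
  swap; · positivity
  refine (norm_quadrilinear_le hU1 am bn cl dh hc fun l _ => Real.le_sqrt_of_sq_le
    (bilinear_bound hγ hc1 hc2 hM1 hN1 hV1 hQ1 hQM (by positivity) hε1
      (by exact_mod_cast hf1.trans hBl : 1 ≤ B) x (α * l) am bn dh ha hb hd)).trans ?_
  have hexp : (x ^ (1 - 2 * η)) ^ 2 = x ^ (2 - 4 * η) := by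
    rw [← Real.rpow_mul_natCast hx0.le]
    push_cast
    ring_nf
  rw [mul_pow √(9 * _), Real.sq_sqrt, Real.sq_sqrt, hexp, mul_assoc 9 (1474560 + _)]
  · exact mul_le_mul_of_nonneg_left hsize (by norm_num)
  all_goals positivity
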